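/- With ξ₂ fixed and η₂ = 0, let A(v) = Ai(ξ₂+v), K = K_{Ai,ξ₂} the shifted Airy kernel operator, and a₁(ξ₂) = tr (I−K)^{-1} A^{(1)} ⊗ A where A^{(1)}(v) = −A'(v). Then a₁(ξ₂) = −F₂''(ξ₂)/(2F₂(ξ₂)). -/

import Mathlib

open MeasureTheory Complex

/-- The Airy function, defined via the contour integral over the vertical line through 1. -/
noncomputable def Ai (x : ℝ) : ℝ :=
  ((2 * (Real.pi : ℂ) * Complex.I)⁻¹ *
    ∫ t : ℝ, Complex.exp ((1 + (t : ℂ) * Complex.I) ^ 3 / 3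
      - (x : ℂ) * (1 + (t : ℂ) * Complex.I)) * Complex.I).re

/-- The shifted Airy kernel `K_{Ai,ξ}(v₁,v₂) = ∫₀^∞ Ai(ξ+v₁+s)Ai(ξ+v₂+s) ds`. -/
noncomputable def KAi (ξ : ℝ) (v₁ v₂ : ℝ) : ℝ :=
  ∫ s in Set.Ioi (0 : ℝ), Ai (ξ + v₁ + s) * Ai (ξ + v₂ + s)

/-- Composition of integral kernels on `L²(ℝ₊)`. -/
noncomputable def kComp (K L : ℝ → ℝ → ℝ) (v₁ v₂ : ℝ) : ℝ :=
  ∫ l in Set.Ioi (0 : ℝ), K v₁ l * L l v₂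

/-- The Fredholm determinant `det(I + K)` of an integral kernel on `L²(ℝ₊)`. -/
noncomputable def fredholmDet1 (K : ℝ → ℝ → ℝ) : ℝ :=
  ∑' n : ℕ, (1 / (Nat.factorial n) : ℝ) *
    ∫ x in {x : Fin n → ℝ | ∀ i, 0 < x i}, Matrix.det (Matrix.of fun i j => K (x i) (x j))

/-- The GUE Tracy–Widom distribution `F₂(ξ) = det(I − K_{Ai,ξ})`. -/
noncomputable def F₂ (ξ : ℝ) : ℝ := fredholmDet1 (fun v₁ v₂ => -(KAi ξ v₁ v₂))

/-- Hadamard's inequality: the determinant is at most the product of the Euclidean row norms. -/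
theorem Matrix.abs_det_le_prod_sqrt {n : ℕ} (M : Matrix (Fin n) (Fin n) ℝ) :
    |M.det| ≤ ∏ i, √(∑ j, M i j ^ 2) := by
  have : Fact (Module.finrank ℝ (EuclideanSpace ℝ (Fin n)) = n) := ⟨by simp⟩
  set b := EuclideanSpace.basisFun (Fin n) ℝ
  have h := b.toBasis.orientation.abs_volumeForm_apply_le (fun i => WithLp.toLp 2 (M i))
  rw [Orientation.volumeForm_robust _ b rfl, Module.Basis.det_apply] at h
  have hM : b.toBasis.toMatrix (fun i => WithLp.toLp 2 (M i)) = M.transpose := by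
    ext i j
    simp [Module.Basis.toMatrix_apply, b]
  rw [hM, Matrix.det_transpose] at h
  simpa [EuclideanSpace.norm_eq] using h

theorem Matrix.abs_det_le_of_entry_le {n : ℕ} {M : Matrix (Fin n) (Fin n) ℝ} {p q : Fin n → ℝ}
    (hp : ∀ i, 0 ≤ p i) (hq : ∀ i, 0 ≤ q i) (h : ∀ i j, |M i j| ≤ p i * q j) :
    |M.det| ≤ √n ^ n * ((∏ i, p i) * ∏ j, q j) := by
  set N : Matrix (Fin n) (Fin n) ℝ := Matrix.of fun i j => M i j / (p i * q j)
  have hN : ∀ i j, |N i j| ≤ 1 := fun i j => by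
    simp only [N, Matrix.of_apply, abs_div]
    rw [abs_of_nonneg (mul_nonneg (hp i) (hq j))]
    exact div_le_one_of_le₀ (h i j) (mul_nonneg (hp i) (hq j))
  have hMN : M = Matrix.of fun i j => p i * (Matrix.of (fun i j => q j * N i j)) i j := by
    ext i j
    have := h i j
    simp only [N, Matrix.of_apply]
    by_cases h0 : p i * q j = 0
    · rw [h0] at this
      rw [abs_nonpos_iff.mp this]
      simp
    · have h1 : p i ≠ 0 := left_ne_zero_of_mul h0
      have h2 : q j ≠ 0 := right_ne_zero_of_mul h0
      field_simp
  have hdN : |N.det| ≤ √n ^ n := by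
    refine (Matrix.abs_det_le_prod_sqrt N).trans ?_
    calc ∏ i, √(∑ j, N i j ^ 2) ≤ ∏ _i : Fin n, √n := by
          refine Finset.prod_le_prod (fun _ _ => Real.sqrt_nonneg _) fun i _ => ?_
          refine Real.sqrt_le_sqrt ?_
          calc ∑ j, N i j ^ 2 ≤ ∑ _j : Fin n, (1 : ℝ) :=
                Finset.sum_le_sum fun j _ => by
                  rw [← sq_abs]; exact pow_le_one₀ (abs_nonneg _) (hN i j)
            _ = n := by simp
      _ = √n ^ n := by simp
  have hdet : M.det = (∏ i, p i) * ((∏ j, q j) * N.det) := by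
    conv_lhs => rw [hMN]
    rw [Matrix.det_mul_column, Matrix.det_mul_row]
  rw [hdet, abs_mul, abs_mul, abs_of_nonneg (Finset.prod_nonneg fun i _ => hp i),
    abs_of_nonneg (Finset.prod_nonneg fun i _ => hq i)]
  have := Finset.prod_nonneg (fun i (_ : i ∈ Finset.univ) => hp i)
  have := Finset.prod_nonneg (fun i (_ : i ∈ Finset.univ) => hq i)
  calc (∏ i, p i) * ((∏ j, q j) * |N.det|) = |N.det| * ((∏ i, p i) * ∏ j, q j) := by ring
    _ ≤ _ := by gcongr

theorem Matrix.hasDerivAt_det {n : ℕ} {M : ℝ → Matrix (Fin n) (Fin n) ℝ}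
    {M' : Matrix (Fin n) (Fin n) ℝ} {t : ℝ} (h : ∀ i j, HasDerivAt (fun s => M s i j) (M' i j) t) :
    HasDerivAt (fun s => (M s).det) (∑ i, ((M t).updateRow i (M' i)).det) t := by
  let f : ContinuousMultilinearMap ℝ (fun _ : Fin n => Fin n → ℝ) ℝ :=
    ⟨Matrix.detRowAlternating.toMultilinearMap, by
      change Continuous fun M : Matrix (Fin n) (Fin n) ℝ => M.det
      exact Continuous.matrix_det continuous_id⟩
  have hrow : ∀ i, HasFDerivAt (fun s => M s i)
      (ContinuousLinearMap.toSpanSingleton ℝ (M' i)) t := fun i =>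
    (hasDerivAt_pi.mpr fun j => h i j).hasFDerivAt
  have := (HasFDerivAt.multilinear_comp f hrow).hasDerivAt
  simp only [FunLike.coe_sum, Finset.sum_apply, ContinuousLinearMap.comp_apply,
    ContinuousLinearMap.toSpanSingleton_apply, one_smul] at this
  exact this

theorem summable_sqrt_pow_div_factorial (ρ : ℝ) :
    Summable fun n : ℕ => √(n + 1 : ℝ) ^ (n + 1) * ρ ^ n / (n.factorial : ℝ) := by
  have key : ∀ n : ℕ, √(n + 1 : ℝ) ^ (n + 1) ≤ Real.exp (n + 1) * √((n + 1).factorial : ℝ) := by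
    intro n
    have h1 := Real.pow_div_factorial_le_exp (n + 1 : ℝ) (by positivity) (n + 1)
    rw [div_le_iff₀ (by positivity)] at h1
    refine abs_le_of_sq_le_sq' ?_ (by positivity) |>.2
    rw [mul_pow, Real.sq_sqrt (by positivity), pow_right_comm, Real.sq_sqrt (by positivity)]
    refine h1.trans ?_
    gcongr
    rw [← Real.exp_nat_mul]
    apply Real.exp_le_exp.mpr
    push_cast
    linarith [(n.cast_nonneg : (0 : ℝ) ≤ n)]
  set a : ℝ := 2 * Real.exp 1 * |ρ| * 2
  have hb : ∀ n : ℕ, a ^ n / √(n.factorial : ℝ) ≤ Real.exp (a ^ 2) := by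
    intro n
    have h1 := Real.pow_div_factorial_le_exp (a ^ 2) (by positivity) n
    have h2 : a ^ n / √(n.factorial : ℝ) = √((a ^ 2) ^ n / n.factorial) := by
      rw [Real.sqrt_div (by positivity), ← pow_mul, mul_comm 2 n, pow_mul,
        Real.sqrt_sq (by positivity)]
    rw [h2]
    refine Real.sqrt_le_iff.mpr ⟨by positivity, h1.trans ?_⟩
    have := Real.one_le_exp (sq_nonneg a)
    nlinarith
  refine Summable.of_norm_bounded (g := fun n : ℕ => Real.exp 1 * Real.exp (a ^ 2) * (1 / 2) ^ n)
    (summable_geometric_two.mul_left _) fun n => ?_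
  rw [Real.norm_eq_abs, abs_div, abs_mul, abs_pow, abs_pow, abs_of_nonneg (Real.sqrt_nonneg _),
    Nat.abs_cast]
  have hs : √((n + 1).factorial : ℝ) ≤ 2 ^ n * √(n.factorial : ℝ) := by
    refine Real.sqrt_le_iff.mpr ⟨by positivity, ?_⟩
    rw [mul_pow, Real.sq_sqrt (by positivity), Nat.factorial_succ]
    push_cast
    gcongr
    have : n + 1 ≤ 2 ^ n := Nat.lt_two_pow_self
    have h3 : ((n + 1 : ℕ) : ℝ) ≤ 2 ^ n := by exact_mod_cast this
    push_cast at h3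
    have h4 : (1 : ℝ) ≤ 2 ^ n := one_le_pow₀ (by norm_num)
    nlinarith
  have hf : √(n.factorial : ℝ) * √(n.factorial : ℝ) = n.factorial := Real.mul_self_sqrt (by positivity)
  have hfp : 0 < √(n.factorial : ℝ) := Real.sqrt_pos.mpr (by positivity)
  calc √(n + 1 : ℝ) ^ (n + 1) * |ρ| ^ n / (n.factorial : ℝ)
      ≤ (Real.exp (n + 1) * (2 ^ n * √(n.factorial : ℝ))) * |ρ| ^ n / (n.factorial : ℝ) := by
        gcongr
        exact (key n).trans (by gcongr)
    _ = Real.exp 1 * (a ^ n / √(n.factorial : ℝ)) * (1 / 2) ^ n := by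
        rw [Real.exp_add, show (n : ℝ) = n * 1 by simp, Real.exp_nat_mul]
        generalize √(n.factorial : ℝ) = q at hf hfp
        rw [← hf]
        simp only [a, mul_pow, one_div, inv_pow]
        field_simp
    _ ≤ _ := by gcongr; exact hb n

/-- A nonnegative square integrable weight. -/
structure IsWeight (μ : Measure ℝ) (w : ℝ → ℝ) : Prop where
  measurable : Measurable w
  nonneg : ∀ x, 0 ≤ w x
  integrable_sq : Integrable (fun x => w x ^ 2) μ

/-- A measurable kernel dominated by `C w(x) w(y)`. -/
structure IsDominatedKernel (w : ℝ → ℝ) (C : ℝ) (K : ℝ → ℝ → ℝ) : Prop where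
  measurable : Measurable (Function.uncurry K)
  abs_le : ∀ x y, |K x y| ≤ C * w x * w y

/-- The matrix `K(xᵢ, zⱼ)` with columns `z = (y, x₁, …, xₙ)`, bordered by a top row `u(zⱼ)`. -/
def borderedMatrix (K : ℝ → ℝ → ℝ) (u : ℝ → ℝ) {n : ℕ} (y : ℝ) (x : Fin n → ℝ) :
    Matrix (Fin (n + 1)) (Fin (n + 1)) ℝ :=
  Matrix.of (Matrix.vecCons (fun j => u (Matrix.vecCons y x j))
    (fun i j => K (x i) (Matrix.vecCons y x j)))

/-- The integrated determinants of the Fredholm series of `K`. -/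
noncomputable def fredholmCoeff (μ : Measure ℝ) (K : ℝ → ℝ → ℝ) (n : ℕ) : ℝ :=
  ∫ x : Fin n → ℝ, (Matrix.of fun i j => K (x i) (x j)).det ∂Measure.pi fun _ => μ

/-- The integrated bordered determinants of `K`. -/
noncomputable def borderedCoeff (μ : Measure ℝ) (K : ℝ → ℝ → ℝ) (u : ℝ → ℝ) (n : ℕ) (y : ℝ) : ℝ :=
  ∫ x : Fin n → ℝ, (borderedMatrix K u y x).det ∂Measure.pi fun _ => μ

theorem Measurable.det_of {α : Type*} [MeasurableSpace α] {n : ℕ}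
    {M : α → Matrix (Fin n) (Fin n) ℝ} (h : ∀ i j, Measurable fun a => M a i j) :
    Measurable fun a => (M a).det := by
  simp only [Matrix.det_apply']
  exact Finset.measurable_sum _ fun σ _ =>
    (Finset.measurable_prod _ fun i _ => h (σ i) i).const_mul _

theorem measurable_vecCons {α : Type*} [MeasurableSpace α] {n : ℕ} {f : α → ℝ} {g : α → Fin n → ℝ}
    (hf : Measurable f) (hg : Measurable g) (j : Fin (n + 1)) :
    Measurable fun a => Matrix.vecCons (f a) (g a) j := by
  refine Fin.cases ?_ (fun i => ?_) j
  · simpa using hf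
  · simpa [Function.comp_def] using (measurable_pi_apply i).comp hg

theorem measurable_det_borderedMatrix {α : Type*} [MeasurableSpace α] {n : ℕ} {K : ℝ → ℝ → ℝ}
    {u : α → ℝ → ℝ} (hK : Measurable (Function.uncurry K)) (hu : Measurable (Function.uncurry u))
    {f : α → ℝ} {g : α → Fin n → ℝ} (hf : Measurable f) (hg : Measurable g) :
    Measurable fun a => (borderedMatrix K (u a) (f a) (g a)).det := by
  refine Measurable.det_of fun i j => ?_
  refine Fin.cases ?_ (fun i => ?_) i
  · exact hu.comp (measurable_id.prodMk (measurable_vecCons hf hg j))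
  · exact hK.comp (((measurable_pi_apply i).comp hg).prodMk (measurable_vecCons hf hg j))

theorem borderedMatrix_kernel_row (K : ℝ → ℝ → ℝ) {n : ℕ} (l y : ℝ) (x : Fin n → ℝ) :
    borderedMatrix K (K l) y x =
      Matrix.of fun i j => K (Matrix.vecCons l x i) (Matrix.vecCons y x j) := by
  ext i j
  refine Fin.cases ?_ (fun i => ?_) i <;> simp [borderedMatrix]

theorem borderedCoeff_zero {μ : Measure ℝ} {K : ℝ → ℝ → ℝ} {u : ℝ → ℝ} (y : ℝ) : borderedCoeff μ K u 0 y = u y := by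
  simp [borderedCoeff, borderedMatrix, Measure.pi_of_empty (fun _ : Fin 0 => μ)]

theorem fredholmCoeff_zero {μ : Measure ℝ} {K : ℝ → ℝ → ℝ} : fredholmCoeff μ K 0 = 1 := by
  simp [fredholmCoeff, Measure.pi_of_empty (fun _ : Fin 0 => μ)]

theorem borderedCoeff_symm {μ : Measure ℝ} {K : ℝ → ℝ → ℝ} (hK : ∀ x y, K x y = K y x) (n : ℕ) (a b : ℝ) :
    borderedCoeff μ K (K a) n b = borderedCoeff μ K (K b) n a := by
  simp only [borderedCoeff, borderedMatrix_kernel_row]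
  refine integral_congr_ae (Filter.Eventually.of_forall fun x => ?_)
  change Matrix.det _ = Matrix.det _
  rw [← Matrix.det_transpose]
  congr 1
  ext i j
  simp [hK (Matrix.vecCons a x j)]

section
variable {μ : Measure ℝ} [SigmaFinite μ] {w : ℝ → ℝ} {C : ℝ} {K : ℝ → ℝ → ℝ} {u : ℝ → ℝ}

theorem abs_det_borderedMatrix_le {n : ℕ} {D : ℝ} (hw : ∀ x, 0 ≤ w x) (hC : 0 ≤ C) (hD : 0 ≤ D)
    (hK : ∀ x y, |K x y| ≤ C * w x * w y) (hu : ∀ x, |u x| ≤ D * w x) (y : ℝ) (x : Fin n → ℝ) :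
    |(borderedMatrix K u y x).det| ≤
      √(n + 1 : ℝ) ^ (n + 1) * (D * C ^ n * w y) * ∏ i, w (x i) ^ 2 := by
  have h := Matrix.abs_det_le_of_entry_le (M := borderedMatrix K u y x)
    (p := Matrix.vecCons D fun i => C * w (x i)) (q := fun j => w (Matrix.vecCons y x j))
    (fun i => Fin.cases (by simpa using hD)
      (fun i => by simpa using mul_nonneg hC (hw _)) i) (fun j => hw _)
    (fun i j => Fin.cases (by simpa [borderedMatrix] using hu _)
      (fun i => by simpa [borderedMatrix] using hK _ _) i)
  refine h.trans (le_of_eq ?_)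
  rw [Fin.prod_univ_succ, Fin.prod_univ_succ]
  simp only [Matrix.cons_val_zero, Matrix.cons_val_succ, Finset.prod_mul_distrib,
    Finset.prod_const, Finset.card_univ, Fintype.card_fin, sq]
  push_cast
  ring

theorem abs_det_kernel_le {n : ℕ} (hw : ∀ x, 0 ≤ w x) (hC : 0 ≤ C)
    {M : Matrix (Fin n) (Fin n) ℝ} {x : Fin n → ℝ} (hM : ∀ i j, |M i j| ≤ C * w (x i) * w (x j)) :
    |M.det| ≤ √(n : ℝ) ^ n * C ^ n * ∏ i, w (x i) ^ 2 := by
  refine (Matrix.abs_det_le_of_entry_le (p := fun i => C * w (x i)) (q := fun j => w (x j))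
    (fun i => mul_nonneg hC (hw _)) (fun j => hw _) hM).trans (le_of_eq ?_)
  simp only [Finset.prod_mul_distrib, Finset.prod_const, Finset.card_univ, Fintype.card_fin, sq]
  ring

theorem IsWeight.integrable_prod (hw : IsWeight μ w) (n : ℕ) :
    Integrable (fun x : Fin n → ℝ => ∏ i, w (x i) ^ 2) (Measure.pi fun _ => μ) :=
  Integrable.fintype_prod (f := fun _ x => w x ^ 2) fun _ => hw.integrable_sq

theorem IsWeight.integral_prod (n : ℕ) :
    ∫ x : Fin n → ℝ, ∏ i, w (x i) ^ 2 ∂(Measure.pi fun _ => μ) = (∫ x, w x ^ 2 ∂μ) ^ n := by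
  simpa using integral_fintype_prod_eq_pow (ι := Fin n) (μ := μ) (fun x => w x ^ 2)

theorem abs_borderedCoeff_le {D : ℝ} (hw : IsWeight μ w) (hC : 0 ≤ C) (hD : 0 ≤ D)
    (hK : IsDominatedKernel w C K) (hu : ∀ x, |u x| ≤ D * w x) (n : ℕ) (y : ℝ) :
    |borderedCoeff μ K u n y| ≤
      √(n + 1 : ℝ) ^ (n + 1) * (D * C ^ n * w y) * (∫ x, w x ^ 2 ∂μ) ^ n := by
  rw [← IsWeight.integral_prod, ← integral_const_mul]
  exact norm_integral_le_of_norm_le ((hw.integrable_prod n).const_mul _)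
    (f := fun x : Fin n → ℝ => (borderedMatrix K u y x).det) (Filter.Eventually.of_forall fun x =>
      abs_det_borderedMatrix_le hw.nonneg hC hD hK.abs_le hu y x)

theorem measurable_det_kernel (hK : Measurable (Function.uncurry K)) (n : ℕ) :
    Measurable fun x : Fin n → ℝ => (Matrix.of fun i j => K (x i) (x j)).det :=
  Measurable.det_of (M := fun x : Fin n → ℝ => Matrix.of fun i j => K (x i) (x j)) fun i j => by
    have h : Measurable fun x : Fin n → ℝ => (x i, x j) :=
      (measurable_pi_apply i).prodMk (measurable_pi_apply j)
    exact hK.comp h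

theorem integrable_det_kernel (hw : IsWeight μ w) (hC : 0 ≤ C) (hK : IsDominatedKernel w C K)
    (n : ℕ) :
    Integrable (fun x : Fin n → ℝ => (Matrix.of fun i j => K (x i) (x j)).det)
      (Measure.pi fun _ => μ) :=
  ((hw.integrable_prod n).const_mul _).mono' (measurable_det_kernel hK.measurable n).aestronglyMeasurable
    (Filter.Eventually.of_forall fun x =>
      abs_det_kernel_le hw.nonneg hC (x := x) fun _ _ => hK.abs_le _ _)

theorem abs_fredholmCoeff_le (hw : IsWeight μ w) (hC : 0 ≤ C) (hK : IsDominatedKernel w C K)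
    (n : ℕ) : |fredholmCoeff μ K n| ≤ √(n : ℝ) ^ n * C ^ n * (∫ x, w x ^ 2 ∂μ) ^ n := by
  rw [← IsWeight.integral_prod, ← integral_const_mul]
  exact norm_integral_le_of_norm_le ((hw.integrable_prod n).const_mul _)
    (f := fun x : Fin n → ℝ => (Matrix.of fun i j => K (x i) (x j)).det)
    (Filter.Eventually.of_forall fun x =>
      abs_det_kernel_le hw.nonneg hC (x := x) fun _ _ => hK.abs_le _ _)

theorem integral_pi_succAbove {n : ℕ} (k : Fin (n + 1)) {g : ℝ → (Fin n → ℝ) → ℝ}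
    (hg : Integrable (Function.uncurry g) (μ.prod (Measure.pi fun _ => μ))) :
    ∫ x : Fin (n + 1) → ℝ, g (x k) (fun i => x (k.succAbove i)) ∂(Measure.pi fun _ => μ) =
      ∫ l, ∫ x, g l x ∂(Measure.pi fun _ => μ) ∂μ := by
  have h := (measurePreserving_piFinSuccAbove (fun _ : Fin (n + 1) => μ) k).integral_comp
    (MeasurableEquiv.piFinSuccAbove (fun _ => ℝ) k).measurableEmbedding (Function.uncurry g)
  rw [integral_prod _ hg] at h
  exact h

theorem integrable_pi_succAbove {n : ℕ} (k : Fin (n + 1)) {g : ℝ → (Fin n → ℝ) → ℝ}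
    (hg : Integrable (Function.uncurry g) (μ.prod (Measure.pi fun _ => μ))) :
    Integrable (fun x : Fin (n + 1) → ℝ => g (x k) (fun i => x (k.succAbove i)))
      (Measure.pi fun _ => μ) :=
  (measurePreserving_piFinSuccAbove (fun _ : Fin (n + 1) => μ) k).integrable_comp_of_integrable hg

theorem det_submatrix_cycleRange {n : ℕ} (k : Fin (n + 1)) (x : Fin (n + 1) → ℝ)
    (f : ℝ → Fin (n + 1) → ℝ) :
    (Matrix.of fun i j => f (Matrix.vecCons (x k) (fun i => x (k.succAbove i)) i) j).det =
      (-1) ^ (k : ℕ) * (Matrix.of fun i j => f (x i) j).det := by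
  have h := Matrix.det_permute k.cycleRange.symm (Matrix.of fun i j => f (x i) j)
  rw [Equiv.Perm.sign_symm, Fin.sign_cycleRange] at h
  push_cast at h
  rw [← h]
  congr 1
  ext i j
  refine Fin.cases ?_ (fun i => ?_) i
  · simp [Fin.cycleRange_symm_zero]
  · simp [Fin.cycleRange_symm_succ]

theorem det_borderedMatrix_succ (K : ℝ → ℝ → ℝ) (u : ℝ → ℝ) {n : ℕ} (y : ℝ)
    (x : Fin (n + 1) → ℝ) :
    (borderedMatrix K u y x).det = u y * (Matrix.of fun i j => K (x i) (x j)).det -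
      ∑ k, u (x k) * (borderedMatrix K (K (x k)) y fun i => x (k.succAbove i)).det := by
  rw [Matrix.det_succ_row_zero, Fin.sum_univ_succ, sub_eq_add_neg, ← Finset.sum_neg_distrib]
  congr 1
  · simp only [borderedMatrix, Fin.val_zero, pow_zero, one_mul, Matrix.of_apply,
      Matrix.cons_val_zero]
    congr 2
  · refine Finset.sum_congr rfl fun k _ => ?_
    rw [borderedMatrix_kernel_row, det_submatrix_cycleRange k x
      (fun a j => K a (Matrix.vecCons y (fun i => x (k.succAbove i)) j))]
    have : (borderedMatrix K u y x).submatrix Fin.succ k.succ.succAbove =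
        Matrix.of fun i j => K (x i) (Matrix.vecCons y (fun i => x (k.succAbove i)) j) := by
      ext i j
      refine Fin.cases ?_ (fun j => ?_) j <;> simp [borderedMatrix]
    rw [this]
    simp only [borderedMatrix, Matrix.of_apply, Matrix.cons_val_zero, Matrix.cons_val_succ,
      Fin.val_succ, pow_succ]
    ring

theorem integrable_uncurry_mul_det {E : ℝ} (hw : IsWeight μ w) (hC : 0 ≤ C)
    (hK : IsDominatedKernel w C K) (hum : Measurable u) {v : ℝ → ℝ → ℝ}
    (hvm : Measurable (Function.uncurry v)) {f : ℝ → ℝ} (hf : Measurable f) {D : ℝ → ℝ}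
    (hD : ∀ l, 0 ≤ D l) (hv : ∀ l x, |v l x| ≤ D l * w x)
    (hE : ∀ l, |u l| * (D l * w (f l)) ≤ E * w l ^ 2) (n : ℕ) :
    Integrable (Function.uncurry fun l (x : Fin n → ℝ) =>
      u l * (borderedMatrix K (v l) (f l) x).det) (μ.prod (Measure.pi fun _ => μ)) := by
  have hdom : Integrable (fun p : ℝ × (Fin n → ℝ) =>
      (√(n + 1 : ℝ) ^ (n + 1) * (E * C ^ n)) * (w p.1 ^ 2 * ∏ i, w (p.2 i) ^ 2))
      (μ.prod (Measure.pi fun _ => μ)) :=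
    (hw.integrable_sq.mul_prod (hw.integrable_prod n)).const_mul _
  refine hdom.mono' ?_ (Filter.Eventually.of_forall fun p => ?_)
  · refine Measurable.aestronglyMeasurable ?_
    have hm : Measurable (Function.uncurry fun (p : ℝ × (Fin n → ℝ)) => v p.1) :=
      hvm.comp ((measurable_fst.comp measurable_fst).prodMk measurable_snd)
    exact (hum.comp measurable_fst).mul (measurable_det_borderedMatrix hK.measurable hm
      (hf.comp measurable_fst) measurable_snd)
  · obtain ⟨l, x⟩ := p
    have hdet := abs_det_borderedMatrix_le hw.nonneg hC (hD l) hK.abs_le (hv l) (f l) x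
    have h0 : 0 ≤ ∏ i, w (x i) ^ 2 := Finset.prod_nonneg fun i _ => sq_nonneg _
    simp only [Function.uncurry, norm_mul, Real.norm_eq_abs]
    calc |u l| * |(borderedMatrix K (v l) (f l) x).det|
        ≤ |u l| * (√(n + 1 : ℝ) ^ (n + 1) * (D l * C ^ n * w (f l)) * ∏ i, w (x i) ^ 2) := by
          gcongr
      _ = (√(n + 1 : ℝ) ^ (n + 1) * C ^ n * ∏ i, w (x i) ^ 2) * (|u l| * (D l * w (f l))) := by
          ring
      _ ≤ (√(n + 1 : ℝ) ^ (n + 1) * C ^ n * ∏ i, w (x i) ^ 2) * (E * w l ^ 2) := by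
          exact mul_le_mul_of_nonneg_left (hE l) (by positivity)
      _ = _ := by ring

theorem borderedCoeff_succ {D : ℝ} (hw : IsWeight μ w) (hC : 0 ≤ C)
    (hK : IsDominatedKernel w C K) (hum : Measurable u) (hu : ∀ x, |u x| ≤ D * w x) (n : ℕ)
    (y : ℝ) :
    borderedCoeff μ K u (n + 1) y = u y * fredholmCoeff μ K (n + 1) -
      (n + 1) * ∫ l, u l * borderedCoeff μ K (K l) n y ∂μ := by
  have hint := integrable_uncurry_mul_det (E := D * C * w y) hw hC hK hum hK.measurable
    (measurable_const (a := y)) (D := fun l => C * w l) (fun l => mul_nonneg hC (hw.nonneg l))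
    (fun l x => hK.abs_le l x) (fun l => by
      have := hw.nonneg l
      have := hw.nonneg y
      calc |u l| * (C * w l * w y) ≤ (D * w l) * (C * w l * w y) := by gcongr; exact hu l
        _ = _ := by ring) n
  have hk := fun k => integral_pi_succAbove (μ := μ) k hint
  simp only [borderedCoeff, det_borderedMatrix_succ]
  rw [integral_sub ((integrable_det_kernel hw hC hK _).const_mul _)
    (integrable_finsetSum _ fun k _ => integrable_pi_succAbove (μ := μ) k hint), integral_const_mul,
    integral_finsetSum _ fun k _ => integrable_pi_succAbove (μ := μ) k hint]
  simp only [hk, integral_const_mul, fredholmCoeff]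
  simp

theorem fredholmCoeff_succ (hw : IsWeight μ w) (hC : 0 ≤ C) (hK : IsDominatedKernel w C K)
    (n : ℕ) : fredholmCoeff μ K (n + 1) = ∫ x, borderedCoeff μ K (K x) n x ∂μ := by
  have hint := integrable_uncurry_mul_det (u := fun _ => 1) (E := C) hw hC hK measurable_const
    hK.measurable measurable_id (D := fun l => C * w l) (fun l => mul_nonneg hC (hw.nonneg l))
    (fun l x => hK.abs_le l x) (fun l => by simp [sq, mul_assoc]) n
  have hk := integral_pi_succAbove (μ := μ) 0 hint
  simp only [borderedMatrix_kernel_row, one_mul] at hk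
  simp only [fredholmCoeff, borderedCoeff, borderedMatrix_kernel_row]
  refine Eq.trans ?_ hk
  refine integral_congr_ae (Filter.Eventually.of_forall fun x => ?_)
  have : (Matrix.vecCons (x 0) fun i => x (Fin.succAbove 0 i)) = x := by
    ext i
    refine Fin.cases ?_ (fun i => ?_) i <;> simp
  simp only [id, this]

theorem measurable_borderedCoeff (hK : Measurable (Function.uncurry K)) {v : ℝ → ℝ → ℝ}
    (hv : Measurable (Function.uncurry v)) (n : ℕ) :
    Measurable (Function.uncurry fun a b => borderedCoeff μ K (v a) n b) := by
  have hm : Measurable (Function.uncurry fun (p : (ℝ × ℝ) × (Fin n → ℝ)) => v p.1.1) :=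
    hv.comp ((measurable_fst.comp (measurable_fst.comp measurable_fst)).prodMk measurable_snd)
  have := measurable_det_borderedMatrix hK hm (f := fun p => p.1.2) (g := fun p => p.2)
    (measurable_snd.comp measurable_fst) measurable_snd
  exact (this.stronglyMeasurable.integral_prod_right (ν := Measure.pi fun _ => μ)).measurable

end

/-- The terms of the Fredholm series of `det(I - K)`. -/
noncomputable def fredholmTerm (μ : Measure ℝ) (K : ℝ → ℝ → ℝ) (n : ℕ) : ℝ :=
  (-1) ^ n / n.factorial * fredholmCoeff μ K n

/-- The terms of the Fredholm series bordered by the row `u`; for `u = K a` these are the terms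
of the first Fredholm minor of `I - K`. -/
noncomputable def borderedTerm (μ : Measure ℝ) (K : ℝ → ℝ → ℝ) (u : ℝ → ℝ) (n : ℕ) (y : ℝ) : ℝ :=
  (-1) ^ n / n.factorial * borderedCoeff μ K u n y

/-- The majorant of the terms of a Fredholm series. -/
noncomputable def fredholmMajorant (ρ : ℝ) (n : ℕ) : ℝ :=
  √(n + 1 : ℝ) ^ (n + 1) * ρ ^ n / n.factorial

theorem fredholmMajorant_nonneg {ρ : ℝ} (hρ : 0 ≤ ρ) (n : ℕ) : 0 ≤ fredholmMajorant ρ n := by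
  unfold fredholmMajorant; positivity

theorem summable_pow_mul_fredholmMajorant (c ρ : ℝ) :
    Summable fun n => c ^ n * fredholmMajorant ρ n := by
  refine (summable_sqrt_pow_div_factorial (c * ρ)).congr fun n => ?_
  rw [fredholmMajorant, mul_pow]
  ring

theorem summable_fredholmMajorant (ρ : ℝ) : Summable (fredholmMajorant ρ) := by
  simpa using summable_pow_mul_fredholmMajorant 1 ρ

theorem summable_natCast_mul {f : ℕ → ℝ} {ρ B : ℝ} (hρ : 0 ≤ ρ)
    (hf : ∀ n, |f n| ≤ B * fredholmMajorant ρ n) {c : ℕ → ℕ} (hc : ∀ n, c n ≤ 2 ^ (n + 1)) :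
    Summable fun n => (c n : ℝ) * f n := by
  refine Summable.of_norm_bounded
    ((summable_pow_mul_fredholmMajorant 2 ρ).mul_left (2 * B)) fun n => ?_
  have h1 : (c n : ℝ) ≤ 2 ^ (n + 1) := by exact_mod_cast hc n
  have := fredholmMajorant_nonneg hρ n
  rw [norm_mul, Real.norm_eq_abs, Real.norm_eq_abs, Nat.abs_cast]
  calc (c n : ℝ) * |f n| ≤ 2 ^ (n + 1) * (B * fredholmMajorant ρ n) := by
        gcongr
        exact hf n
    _ = _ := by ring

theorem choose_le_two_pow_succ (n k : ℕ) : n.choose k ≤ 2 ^ (n + 1) :=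
  (Nat.choose_le_two_pow n k).trans (Nat.pow_le_pow_right (by norm_num) (by simp))

theorem tsum_neg_one_pow_mul_tsum_choose {d : ℕ → ℝ} (hd : Summable fun n => 2 ^ n * |d n|) :
    ∑' k : ℕ, (-1) ^ k * ∑' n, (n.choose k : ℝ) * d n = d 0 := by
  have hfin : ∀ (n : ℕ) (g : ℕ → ℝ), HasSum (fun k => (n.choose k : ℝ) * g k)
      (∑ k ∈ Finset.range (n + 1), (n.choose k : ℝ) * g k) := fun n g =>
    hasSum_sum_of_ne_finset_zero fun k hk => by
      rw [Nat.choose_eq_zero_of_lt (by simpa using hk)]; simp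
  have hs : Summable (Function.uncurry fun (n k : ℕ) => (-1) ^ k * ((n.choose k : ℝ) * d n)) := by
    refine Summable.of_norm ?_
    rw [summable_prod_of_nonneg fun p => norm_nonneg _]
    have h1 : ∀ n k : ℕ, ‖(-1) ^ k * ((n.choose k : ℝ) * d n)‖ = (n.choose k : ℝ) * |d n| := by
      intro n k
      simp
    simp only [Function.uncurry, h1]
    refine ⟨fun n => (hfin n fun _ => |d n|).summable, hd.congr fun n => ?_⟩
    rw [(hfin n fun _ => |d n|).tsum_eq, ← Finset.sum_mul]
    congr 1
    exact_mod_cast (Nat.sum_range_choose n).symm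
  simp only [← tsum_mul_left]
  rw [hs.tsum_comm']
  · have h2 : ∀ n : ℕ, ∑' k : ℕ, (-1) ^ k * ((n.choose k : ℝ) * d n) =
        if n = 0 then d 0 else 0 := by
      intro n
      have h3 := (hfin n fun k => (-1) ^ k * d n).tsum_eq
      have h4 : ∑ k ∈ Finset.range (n + 1), (n.choose k : ℝ) * ((-1) ^ k * d n) =
          ((∑ k ∈ Finset.range (n + 1), ((-1) ^ k * n.choose k : ℤ) : ℤ) : ℝ) * d n := by
        push_cast
        rw [Finset.sum_mul]
        exact Finset.sum_congr rfl fun k _ => by ring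
      rw [Int.alternating_sum_range_choose] at h4
      calc _ = ∑' k : ℕ, (n.choose k : ℝ) * ((-1) ^ k * d n) := tsum_congr fun k => by ring
        _ = _ := by
          rw [h3, h4]
          split_ifs with h
          · simp [h]
          · simp
    simp only [h2]
    rw [tsum_ite_eq]
  · intro n
    exact hs.prod_factor n
  · intro k
    exact hs.comp_injective (i := fun n => (n, k)) fun a b h => (Prod.mk.inj h).1

section
variable {μ : Measure ℝ} [SigmaFinite μ] {w : ℝ → ℝ} {C : ℝ} {K : ℝ → ℝ → ℝ} {u : ℝ → ℝ}

theorem abs_fredholmTerm_le (hw : IsWeight μ w) (hC : 0 ≤ C) (hK : IsDominatedKernel w C K)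
    (n : ℕ) : |fredholmTerm μ K n| ≤ fredholmMajorant (C * ∫ x, w x ^ 2 ∂μ) n := by
  have hW : 0 ≤ ∫ x, w x ^ 2 ∂μ := integral_nonneg fun x => sq_nonneg _
  have h := abs_fredholmCoeff_le hw hC hK n
  have h1 : √(n : ℝ) ^ n ≤ √(n + 1 : ℝ) ^ (n + 1) := by
    calc √(n : ℝ) ^ n ≤ √(n + 1 : ℝ) ^ n := by gcongr; linarith
      _ ≤ √(n + 1 : ℝ) ^ (n + 1) := by
        refine pow_le_pow_right₀ (Real.one_le_sqrt.mpr ?_) (by simp)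
        linarith [(n.cast_nonneg : (0 : ℝ) ≤ n)]
  rw [fredholmTerm, abs_mul, abs_div, abs_pow, abs_neg, abs_one, one_pow, Nat.abs_cast,
    fredholmMajorant, one_div, inv_mul_eq_div]
  gcongr
  refine h.trans ?_
  rw [mul_pow, ← mul_assoc]
  gcongr

theorem abs_borderedTerm_le {D : ℝ} (hw : IsWeight μ w) (hC : 0 ≤ C) (hD : 0 ≤ D)
    (hK : IsDominatedKernel w C K) (hu : ∀ x, |u x| ≤ D * w x) (n : ℕ) (y : ℝ) :
    |borderedTerm μ K u n y| ≤ D * w y * fredholmMajorant (C * ∫ x, w x ^ 2 ∂μ) n := by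
  have h := abs_borderedCoeff_le hw hC hD hK hu n y
  rw [borderedTerm, abs_mul, abs_div, abs_pow, abs_neg, abs_one, one_pow, Nat.abs_cast,
    fredholmMajorant, one_div, inv_mul_eq_div, mul_div_assoc']
  gcongr
  refine h.trans (le_of_eq ?_)
  ring

theorem borderedTerm_succ {D : ℝ} (hw : IsWeight μ w) (hC : 0 ≤ C)
    (hK : IsDominatedKernel w C K) (hum : Measurable u) (hu : ∀ x, |u x| ≤ D * w x) (n : ℕ)
    (y : ℝ) :
    borderedTerm μ K u (n + 1) y = u y * fredholmTerm μ K (n + 1) +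
      ∫ l, u l * borderedTerm μ K (K l) n y ∂μ := by
  have h1 : ∀ l, u l * borderedTerm μ K (K l) n y =
      (-1) ^ n / n.factorial * (u l * borderedCoeff μ K (K l) n y) := fun l => by
    rw [borderedTerm]; ring
  simp only [h1]
  rw [integral_const_mul, borderedTerm, fredholmTerm, borderedCoeff_succ hw hC hK hum hu,
    Nat.factorial_succ]
  push_cast
  field_simp
  ring

theorem succ_mul_fredholmTerm_succ (hw : IsWeight μ w) (hC : 0 ≤ C)
    (hK : IsDominatedKernel w C K) (n : ℕ) :
    (n + 1) * fredholmTerm μ K (n + 1) = -∫ x, borderedTerm μ K (K x) n x ∂μ := by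
  simp only [borderedTerm]
  rw [integral_const_mul, fredholmTerm, fredholmCoeff_succ hw hC hK, Nat.factorial_succ]
  push_cast
  field_simp
  ring

theorem measurable_borderedTerm (hK : Measurable (Function.uncurry K)) {v : ℝ → ℝ → ℝ}
    (hv : Measurable (Function.uncurry v)) (n : ℕ) :
    Measurable (Function.uncurry fun a b => borderedTerm μ K (v a) n b) :=
  (measurable_borderedCoeff (μ := μ) hK hv n).const_mul _

theorem hasSum_integral_of_majorant {α : Type*} [MeasurableSpace α] {ν : Measure α}
    {f : ℕ → α → ℝ} {g : α → ℝ} {β : ℕ → ℝ} (hf : ∀ n, AEStronglyMeasurable (f n) ν)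
    (hg : Integrable g ν) (hβ : Summable β) (h : ∀ n a, |f n a| ≤ g a * β n) :
    HasSum (fun n => ∫ a, f n a ∂ν) (∫ a, ∑' n, f n a ∂ν) := by
  have hi : ∀ n, Integrable (f n) ν := fun n =>
    (hg.mul_const (β n)).mono' (hf n) (Filter.Eventually.of_forall (h n))
  refine hasSum_integral_of_summable_integral_norm hi
    (Summable.of_nonneg_of_le (fun n => integral_nonneg fun a => norm_nonneg _) (fun n => ?_)
      (hβ.mul_left (∫ a, g a ∂ν)))
  rw [← integral_mul_const]
  exact integral_mono (hi n).norm (hg.mul_const _) (h n)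

/-- If the resolvent kernel `R = K + K R` exists, then `det(I - K) ≠ 0` and the first Fredholm
minor is `det(I - K) R`. -/
theorem fredholm_resolvent {R : ℝ → ℝ → ℝ} (hw : IsWeight μ w) (hC : 0 ≤ C)
    (hK : IsDominatedKernel w C K) (hsymm : ∀ x y, K x y = K y x)
    (hRm : ∀ y, AEStronglyMeasurable (fun l => R l y) μ)
    (hRb : ∀ y, ∃ B, ∀ l, |R l y| ≤ B * w l)
    (hR : ∀ a y, R a y = K a y + ∫ l, K a l * R l y ∂μ) :
    ∑' n, fredholmTerm μ K n ≠ 0 ∧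
      ∀ a y, ∑' n, borderedTerm μ K (K a) n y = (∑' n, fredholmTerm μ K n) * R a y := by
  set W := ∫ x, w x ^ 2 ∂μ
  have hW : 0 ≤ W := integral_nonneg fun x => sq_nonneg _
  have hρ : 0 ≤ C * W := mul_nonneg hC hW
  set β := fredholmMajorant (C * W)
  have hβ0 : ∀ n, 0 ≤ β n := fredholmMajorant_nonneg hρ
  set d := fredholmTerm μ K
  set D : ℕ → ℝ → ℝ → ℝ := fun n a y => borderedTerm μ K (K a) n y
  have hKa : ∀ a, Measurable (K a) := fun a => hK.measurable.comp measurable_prodMk_left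
  have hCw : ∀ a, 0 ≤ C * w a := fun a => mul_nonneg hC (hw.nonneg a)
  have hd : ∀ n, |d n| ≤ 1 * β n := fun n => by
    simpa using abs_fredholmTerm_le hw hC hK n
  have hD : ∀ n a y, |D n a y| ≤ C * w a * w y * β n := fun n a y =>
    abs_borderedTerm_le hw hC (hCw a) hK (hK.abs_le a) n y
  have hDm : ∀ n, Measurable (Function.uncurry (D n)) := fun n =>
    measurable_borderedTerm hK.measurable hK.measurable n
  have hDsymm : ∀ n a y, D n a y = D n y a := fun n a y => by
    simp only [D, borderedTerm, borderedCoeff_symm hsymm n a y]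
  have hDzero : ∀ a y, D 0 a y = d 0 * K a y := fun a y => by
    simp [D, d, borderedTerm, fredholmTerm, borderedCoeff_zero, fredholmCoeff_zero]
  have hDsucc : ∀ n a y, D (n + 1) a y = d (n + 1) * K a y + ∫ l, D n a l * K l y ∂μ := by
    intro n a y
    rw [hDsymm]
    have := borderedTerm_succ hw hC hK (hKa y) (hK.abs_le y) n a
    refine this.trans ?_
    rw [hsymm y a, mul_comm]
    congr 1
    refine integral_congr_ae (Filter.Eventually.of_forall fun l => ?_)
    change K y l * D n l a = D n a l * K l y
    rw [hDsymm n l a, hsymm y l, mul_comm]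
  set P : ℕ → ℝ → ℝ → ℝ := fun n a y => ∫ l, D n a l * R l y ∂μ
  have hKR : ∀ a y, ∫ l, K a l * R l y ∂μ = R a y - K a y := fun a y => by rw [hR a y]; ring
  have hP0 : ∀ a y, P 0 a y = d 0 * (R a y - K a y) := by
    intro a y
    simp only [P, hDzero, mul_assoc, integral_const_mul, hKR]
  have hintR : ∀ {f : ℝ → ℝ} {B : ℝ} (y : ℝ), Measurable f → (∀ l, |f l| ≤ B * w l) →
      Integrable (fun l => f l * R l y) μ := by
    intro f B y hf hB
    obtain ⟨B', hB'⟩ := hRb y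
    refine (hw.integrable_sq.const_mul (B * B')).mono' (hf.aestronglyMeasurable.mul (hRm y))
      (Filter.Eventually.of_forall fun l => ?_)
    rw [norm_mul, Real.norm_eq_abs, Real.norm_eq_abs]
    calc |f l| * |R l y| ≤ (B * w l) * (B' * w l) :=
          mul_le_mul (hB l) (hB' l) (abs_nonneg _) ((abs_nonneg _).trans (hB l))
      _ = _ := by ring
  have hDa : ∀ n a, Measurable (D n a) := fun n a => (hDm n).comp measurable_prodMk_left
  have hDb : ∀ n a l, |D n a l| ≤ C * w a * β n * w l := fun n a l =>
    (hD n a l).trans (le_of_eq (by ring))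
  have hPsucc : ∀ n a y, P (n + 1) a y = d (n + 1) * (R a y - K a y) + P n a y -
      ∫ m, D n a m * K m y ∂μ := by
    intro n a y
    obtain ⟨B, hB⟩ := hRb y
    have hswap : Integrable (Function.uncurry fun l m => D n a m * K m l * R l y) (μ.prod μ) := by
      have hdom := (hw.integrable_sq.mul_prod hw.integrable_sq).const_mul (C * w a * β n * C * B)
      refine hdom.mono' ?_ (Filter.Eventually.of_forall fun p => ?_)
      · have h1 : Measurable fun p : ℝ × ℝ => D n a p.2 * K p.2 p.1 :=
          ((hDa n a).comp measurable_snd).mul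
            (hK.measurable.comp (measurable_snd.prodMk measurable_fst))
        exact h1.aestronglyMeasurable.mul (hRm y).comp_fst
      · obtain ⟨l, m⟩ := p
        simp only [Function.uncurry, norm_mul, Real.norm_eq_abs]
        calc |D n a m| * |K m l| * |R l y|
            ≤ (C * w a * β n * w m) * (C * w m * w l) * (B * w l) := by
              have h1 := hDb n a m
              have h2 := hK.abs_le m l
              have h3 := hB l
              have h4 := (abs_nonneg _).trans h1
              have h5 := (abs_nonneg _).trans h2
              exact mul_le_mul (mul_le_mul h1 h2 (abs_nonneg _) h4) h3 (abs_nonneg _)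
                (mul_nonneg h4 h5)
          _ = _ := by ring
    have h1 : ∀ l, D (n + 1) a l * R l y =
        d (n + 1) * (K a l * R l y) + ∫ m, D n a m * K m l * R l y ∂μ := by
      intro l
      rw [hDsucc, integral_mul_const]
      ring
    have hi1 : Integrable (fun l => d (n + 1) * (K a l * R l y)) μ :=
      (hintR y (hKa a) (hK.abs_le a)).const_mul _
    have hi2' : Integrable (fun l => ∫ m, D n a m * K m l * R l y ∂μ) μ :=
      hswap.integral_prod_left
    simp only [P, h1]
    rw [integral_add hi1 hi2', integral_const_mul, hKR,
      integral_integral_swap hswap]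
    have h2 : ∀ m, ∫ l, D n a m * K m l * R l y ∂μ = D n a m * R m y - D n a m * K m y := by
      intro m
      simp only [mul_assoc, integral_const_mul, hKR]
      ring
    have hi2 : Integrable (fun m => D n a m * K m y) μ := by
      refine (hw.integrable_sq.const_mul (C * w a * β n * (C * w y))).mono'
        ((hDa n a).mul (hK.measurable.comp measurable_prodMk_right)).aestronglyMeasurable
        (Filter.Eventually.of_forall fun m => ?_)
      rw [norm_mul, Real.norm_eq_abs, Real.norm_eq_abs]
      calc |D n a m| * |K m y| ≤ (C * w a * β n * w m) * (C * w m * w y) :=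
            mul_le_mul (hDb n a m) (hK.abs_le m y) (abs_nonneg _)
              ((abs_nonneg _).trans (hDb n a m))
        _ = _ := by ring
    simp only [h2]
    rw [integral_sub (hintR y (hDa n a) (hDb n a)) hi2]
    ring
  have hPb : ∀ a y, ∃ B, 0 ≤ B ∧ ∀ n, |P n a y| ≤ B * β n := by
    intro a y
    obtain ⟨B, hB⟩ := hRb y
    refine ⟨C * w a * |B| * W, by have := hCw a; positivity, fun n => ?_⟩
    have : C * w a * |B| * W * β n = ∫ l, C * w a * |B| * β n * w l ^ 2 ∂μ := by
      rw [integral_const_mul]; ring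
    rw [this]
    refine norm_integral_le_of_norm_le (f := fun l => D n a l * R l y)
      (hw.integrable_sq.const_mul _) (Filter.Eventually.of_forall fun l => ?_)
    rw [norm_mul, Real.norm_eq_abs, Real.norm_eq_abs]
    calc |D n a l| * |R l y| ≤ (C * w a * β n * w l) * (|B| * w l) := by
          refine mul_le_mul (hDb n a l) ((hB l).trans ?_) (abs_nonneg _)
            ((abs_nonneg _).trans (hDb n a l))
          exact mul_le_mul_of_nonneg_right (le_abs_self B) (hw.nonneg l)
      _ = _ := by ring
  have hsum_d : ∀ k, Summable fun n => ((n.choose k : ℕ) : ℝ) * d n := fun k =>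
    summable_natCast_mul hρ hd fun n => choose_le_two_pow_succ n k
  have hsum_P : ∀ k a y, Summable fun n => ((n.choose k : ℕ) : ℝ) * P n a y := fun k a y => by
    obtain ⟨B, hB0, hB⟩ := hPb a y
    exact summable_natCast_mul hρ hB fun n => choose_le_two_pow_succ n k
  have hsum_P' : ∀ k a y, Summable fun n => (((n + 1).choose k : ℕ) : ℝ) * P n a y :=
    fun k a y => by
      obtain ⟨B, hB0, hB⟩ := hPb a y
      exact summable_natCast_mul hρ hB fun n => Nat.choose_le_two_pow (n + 1) k
  have hsum_D : ∀ k a y, Summable fun n => ((n.choose k : ℕ) : ℝ) * D n a y := fun k a y =>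
    summable_natCast_mul hρ (fun n => hD n a y)
      fun n => choose_le_two_pow_succ n k
  set t : ℕ → ℝ := fun k => ∑' n : ℕ, (n.choose k : ℝ) * d n
  set T : ℕ → ℝ → ℝ → ℝ := fun k a y => ∑' n : ℕ, (n.choose k : ℝ) * D n a y
  have hT : ∀ k a y, T k a y = t k * R a y + (∑' n : ℕ, ((n + 1).choose k : ℝ) * P n a y -
      ∑' n : ℕ, (n.choose k : ℝ) * P n a y) := by
    intro k a y
    have e1 : T k a y + ∑' n : ℕ, (n.choose k : ℝ) * P n a y = t k * R a y +
        ∑' n : ℕ, ((n + 1).choose k : ℝ) * P n a y := by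
      have hsl := (hsum_D k a y).add (hsum_P k a y)
      have hsr := (hsum_d k).mul_right (R a y)
      have hl := hsl.tsum_eq_zero_add
      have hr := hsr.tsum_eq_zero_add
      have hr' := ((summable_nat_add_iff 1).mpr hsr).tsum_add (hsum_P' k a y)
      have htail : ∑' n : ℕ, (((n + 1).choose k : ℝ) * D (n + 1) a y +
          ((n + 1).choose k : ℝ) * P (n + 1) a y) = ∑' n : ℕ, (((n + 1).choose k : ℝ) *
            d (n + 1) * R a y + ((n + 1).choose k : ℝ) * P n a y) := by
        refine tsum_congr fun n => ?_
        rw [hPsucc, hDsucc]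
        ring
      have hhead : ((0 : ℕ).choose k : ℝ) * D 0 a y + ((0 : ℕ).choose k : ℝ) * P 0 a y =
          ((0 : ℕ).choose k : ℝ) * d 0 * R a y := by
        rw [hDzero, hP0]
        ring
      simp only [T, t]
      rw [← (hsum_D k a y).tsum_add (hsum_P k a y), ← tsum_mul_right, hl, hr, htail, hhead, hr']
      ring
    linarith
  have hT0 : ∀ a y, T 0 a y = t 0 * R a y := by
    intro a y
    rw [hT]
    simp
  have hTsucc : ∀ k a y, T (k + 1) a y = t (k + 1) * R a y + ∫ l, T k a l * R l y ∂μ := by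
    intro k a y
    rw [hT]
    congr 1
    rw [← (hsum_P' (k + 1) a y).tsum_sub (hsum_P (k + 1) a y)]
    obtain ⟨B, hB⟩ := hRb y
    have hint := hasSum_integral_of_majorant (ν := μ)
      (f := fun n l => (n.choose k : ℝ) * (D n a l * R l y))
      (g := fun l => C * w a * |B| * w l ^ 2)
      (β := fun n => 2 ^ n * β n)
      (fun n => ((hDa n a).aestronglyMeasurable.mul (hRm y)).const_mul _)
      (hw.integrable_sq.const_mul _) (summable_pow_mul_fredholmMajorant 2 _) (fun n l => by
        have hc : (n.choose k : ℝ) ≤ 2 ^ n := by exact_mod_cast Nat.choose_le_two_pow n k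
        rw [abs_mul, abs_mul, Nat.abs_cast]
        calc (n.choose k : ℝ) * (|D n a l| * |R l y|)
            ≤ 2 ^ n * ((C * w a * β n * w l) * (|B| * w l)) := by
              refine mul_le_mul hc ?_ (by positivity) (by positivity)
              refine mul_le_mul (hDb n a l) ((hB l).trans ?_) (abs_nonneg _)
                ((abs_nonneg _).trans (hDb n a l))
              exact mul_le_mul_of_nonneg_right (le_abs_self B) (hw.nonneg l)
          _ = _ := by ring)
    calc ∑' n : ℕ, (((n + 1).choose (k + 1) : ℝ) * P n a y - (n.choose (k + 1) : ℝ) * P n a y)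
        = ∑' n : ℕ, ∫ l, (n.choose k : ℝ) * (D n a l * R l y) ∂μ := by
          refine tsum_congr fun n => ?_
          rw [integral_const_mul, Nat.choose_succ_succ]
          push_cast
          ring
      _ = ∫ l, ∑' n : ℕ, (n.choose k : ℝ) * (D n a l * R l y) ∂μ := hint.tsum_eq
      _ = _ := by
          simp only [T, ← mul_assoc, tsum_mul_right]
  have htsucc : ∀ k : ℕ, (k + 1) * t (k + 1) = -∫ x, T k x x ∂μ := by
    intro k
    have hint := hasSum_integral_of_majorant (ν := μ)
      (f := fun n x => (n.choose k : ℝ) * D n x x) (g := fun x => C * w x ^ 2)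
      (β := fun n => 2 ^ n * β n)
      (fun n => (((hDm n).comp (measurable_id.prodMk measurable_id)).const_mul
        _).aestronglyMeasurable)
      (hw.integrable_sq.const_mul _) (summable_pow_mul_fredholmMajorant 2 _) (fun n x => by
        have hc : (n.choose k : ℝ) ≤ 2 ^ n := by exact_mod_cast Nat.choose_le_two_pow n k
        rw [abs_mul, Nat.abs_cast]
        calc (n.choose k : ℝ) * |D n x x| ≤ 2 ^ n * (C * w x * w x * β n) := by
              gcongr
              exact hD n x x
          _ = _ := by ring)
    rw [← hint.tsum_eq, ← tsum_mul_left, ← tsum_neg,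
      ((hsum_d (k + 1)).mul_left ((k : ℝ) + 1)).tsum_eq_zero_add]
    simp only [Nat.choose_zero_succ, Nat.cast_zero, zero_mul, mul_zero, zero_add]
    refine tsum_congr fun n => ?_
    have h1 := succ_mul_fredholmTerm_succ hw hC hK n
    have h2 : ((k : ℝ) + 1) * ((n + 1).choose (k + 1) : ℝ) = (n + 1) * (n.choose k : ℝ) := by
      have := Nat.add_one_mul_choose_eq n k
      have h3 : ((n : ℝ) + 1) * (n.choose k : ℝ) = ((n + 1).choose (k + 1) : ℝ) * (k + 1) := by
        exact_mod_cast this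
      linarith
    rw [← mul_assoc, h2, integral_const_mul]
    calc ((n : ℝ) + 1) * (n.choose k : ℝ) * d (n + 1) =
        (n.choose k : ℝ) * ((n + 1) * d (n + 1)) := by ring
      _ = _ := by rw [h1]; ring
  have ht0 : t 0 = ∑' n, d n := by simp [t]
  refine ⟨fun h0 => ?_, fun a y => ?_⟩
  · have hall : ∀ k, t k = 0 ∧ ∀ a y, T k a y = 0 := by
      intro k
      induction k with
      | zero =>
        have : t 0 = 0 := ht0.trans h0
        exact ⟨this, fun a y => by rw [hT0, this, zero_mul]⟩
      | succ k ih =>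
        have h1 : t (k + 1) = 0 := by
          have := htsucc k
          simp only [ih.2, integral_zero, neg_zero] at this
          exact (mul_eq_zero.mp this).resolve_left (by positivity)
        exact ⟨h1, fun a y => by rw [hTsucc, h1]; simp [ih.2]⟩
    have hsumm : Summable fun n => 2 ^ n * |d n| :=
      Summable.of_nonneg_of_le (fun n => by positivity)
        (fun n => mul_le_mul_of_nonneg_left (by simpa using hd n) (by positivity))
        (summable_pow_mul_fredholmMajorant 2 _)
    have := tsum_neg_one_pow_mul_tsum_choose hsumm
    have hz : ∑' k : ℕ, (-1) ^ k * t k = 0 := by simp [hall]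
    have hd0 : d 0 = 1 := by simp [d, fredholmTerm, fredholmCoeff_zero]
    rw [hd0] at this
    exact zero_ne_one (hz.symm.trans this)
  · have := hT0 a y
    rw [ht0] at this
    simpa [T] using this
end

/-- A series of iterated integrals with Fredholm majorants may be differentiated termwise. -/
theorem hasDerivAt_fredholm_series {μ : Measure ℝ} [SigmaFinite μ] {w : ℝ → ℝ}
    (hw : IsWeight μ w) {G G' : (n : ℕ) → ℝ → (Fin n → ℝ) → ℝ} {t C : ℝ}
    (hG : ∀ n s, Measurable (G n s)) (hG' : ∀ n s, Measurable (G' n s))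
    (hderiv : ∀ n s x, HasDerivAt (fun s => G n s x) (G' n s x) s)
    (hb : ∀ n, ∀ s ∈ Metric.ball t 1, ∀ x,
      |G n s x| ≤ √(n + 1 : ℝ) ^ (n + 1) * C ^ n * ∏ i, w (x i) ^ 2)
    (hb' : ∀ n, ∀ s ∈ Metric.ball t 1, ∀ x,
      |G' n s x| ≤ √(n + 1 : ℝ) ^ (n + 1) * C ^ n * ∏ i, w (x i) ^ 2) :
    HasDerivAt (fun s => ∑' n : ℕ, (-1) ^ n / n.factorial * ∫ x, G n s x ∂Measure.pi fun _ => μ)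
      (∑' n : ℕ, (-1) ^ n / n.factorial * ∫ x, G' n t x ∂Measure.pi fun _ => μ) t := by
  set W := ∫ x, w x ^ 2 ∂μ
  have hint : ∀ n, Integrable
      (fun x : Fin n → ℝ => √(n + 1 : ℝ) ^ (n + 1) * C ^ n * ∏ i, w (x i) ^ 2)
      (Measure.pi fun _ => μ) := fun n => (hw.integrable_prod n).const_mul _
  have hbound : ∀ n (H : (Fin n → ℝ) → ℝ),
      (∀ x, |H x| ≤ √(n + 1 : ℝ) ^ (n + 1) * C ^ n * ∏ i, w (x i) ^ 2) →
      |(-1) ^ n / n.factorial * ∫ x, H x ∂Measure.pi fun _ => μ| ≤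
        fredholmMajorant (C * W) n := by
    intro n H hH
    have h1 : |∫ x, H x ∂Measure.pi fun _ => μ| ≤ √(n + 1 : ℝ) ^ (n + 1) * C ^ n * W ^ n := by
      rw [← IsWeight.integral_prod, ← integral_const_mul]
      exact norm_integral_le_of_norm_le (f := H) (hint n) (Filter.Eventually.of_forall hH)
    rw [abs_mul, abs_div, abs_pow, abs_neg, abs_one, one_pow, Nat.abs_cast, fredholmMajorant,
      mul_pow]
    calc 1 / (n.factorial : ℝ) * |∫ x, H x ∂Measure.pi fun _ => μ|
        ≤ 1 / (n.factorial : ℝ) * (√(n + 1 : ℝ) ^ (n + 1) * C ^ n * W ^ n) := by gcongr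
      _ = _ := by ring
  have ht : t ∈ Metric.ball t 1 := Metric.mem_ball_self one_pos
  have hd : ∀ n, ∀ s ∈ Metric.ball t 1, HasDerivAt
      (fun s => (-1) ^ n / n.factorial * ∫ x, G n s x ∂Measure.pi fun _ => μ)
      ((-1) ^ n / n.factorial * ∫ x, G' n s x ∂Measure.pi fun _ => μ) s := by
    intro n s hs
    have hmain := hasDerivAt_integral_of_dominated_loc_of_deriv_le (𝕜 := ℝ) (x₀ := s)
      (μ := Measure.pi fun _ : Fin n => μ) (F := G n) (F' := G' n)
      (bound := fun x => √(n + 1 : ℝ) ^ (n + 1) * C ^ n * ∏ i, w (x i) ^ 2)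
      (Metric.isOpen_ball.mem_nhds hs)
      (Filter.Eventually.of_forall fun s => (hG n s).aestronglyMeasurable)
      ((hint n).mono' (hG n s).aestronglyMeasurable (Filter.Eventually.of_forall (hb n s hs)))
      (hG' n s).aestronglyMeasurable
      (Filter.Eventually.of_forall fun x s hs => hb' n s hs x) (hint n)
      (Filter.Eventually.of_forall fun x s _ => hderiv n s x)
    exact hmain.2.const_mul _
  have hs : Summable fun n : ℕ => (-1 : ℝ) ^ n / n.factorial *
      ∫ x, G n t x ∂Measure.pi fun _ => μ := Summable.of_norm_bounded (summable_fredholmMajorant (C * W))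
    fun n => hbound n _ (hb n t ht)
  exact hasDerivAt_tsum_of_isPreconnected
    (g := fun (n : ℕ) s => (-1 : ℝ) ^ n / n.factorial * ∫ x, G n s x ∂Measure.pi fun _ => μ)
    (g' := fun (n : ℕ) s => (-1 : ℝ) ^ n / n.factorial * ∫ x, G' n s x ∂Measure.pi fun _ => μ)
    (summable_fredholmMajorant (C * W)) Metric.isOpen_ball (convex_ball t 1).isPreconnected hd
    (fun n s hs => hbound n _ (hb' n s hs)) ht hs ht

/-- Exchanging the two vectors in the sum of the row replacements of a symmetric matrix. -/
theorem Matrix.IsSymm.sum_mul_det_updateRow {n : ℕ} {M : Matrix (Fin n) (Fin n) ℝ}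
    (hM : M.IsSymm) (a b : Fin n → ℝ) :
    ∑ i, a i * (M.updateRow i b).det = ∑ i, b i * (M.updateRow i a).det := by
  have h : ∀ a b : Fin n → ℝ, ∑ i, a i * (M.updateRow i b).det = a ⬝ᵥ M.adjugate.mulVec b := by
    intro a b
    simp only [← Matrix.cramer_transpose_apply, hM.eq, Matrix.cramer_eq_adjugate_mulVec, dotProduct]
  rw [h, h, Matrix.dotProduct_mulVec, dotProduct_comm, ← Matrix.mulVec_transpose,
    hM.adjugate.eq]

/-- The first derivative of a determinant whose entries move along `-a ⊗ a`, differentiated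
again, only sees the rows that move twice. -/
theorem Matrix.hasDerivAt_sum_det_updateRow {n : ℕ} {M : ℝ → Matrix (Fin n) (Fin n) ℝ}
    {a : ℝ → Fin n → ℝ} {a' : Fin n → ℝ} {t : ℝ}
    (hM : ∀ i j, HasDerivAt (fun s => M s i j) (-(a t i * a t j)) t)
    (ha : ∀ i, HasDerivAt (fun s => a s i) (a' i) t) :
    HasDerivAt (fun s => ∑ i, ((M s).updateRow i fun j => -(a s i * a s j)).det)
      (∑ i, ((M t).updateRow i fun j => -(a' i * a t j + a t i * a' j)).det) t := by
  refine HasDerivAt.fun_sum fun i _ => ?_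
  set N' : Matrix (Fin n) (Fin n) ℝ :=
    (Matrix.of fun k j => -(a t k * a t j)).updateRow i fun j => -(a' i * a t j + a t i * a' j)
  have h := Matrix.hasDerivAt_det
    (M := fun s => (M s).updateRow i fun j => -(a s i * a s j)) (M' := N') (t := t) (by
      intro k j
      by_cases hk : k = i
      · subst hk
        have h1 : HasDerivAt (fun s => -(a s k * a s j)) (-(a' k * a t j + a t k * a' j)) t :=
          ((ha k).mul (ha j)).fun_neg
        simpa only [N', Matrix.updateRow_self] using h1
      · simpa [N', Matrix.updateRow_ne hk] using hM k j)
  refine h.congr_deriv ?_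
  rw [Finset.sum_eq_single i]
  · simp [N']
  · intro k _ hk
    have hrow : N' k = a t k • fun j => -a t j := by
      ext j
      simp [N', Matrix.updateRow_ne hk]
    rw [hrow, Matrix.det_updateRow_smul, Matrix.updateRow_comm _ hk.symm]
    have hrow' : (fun j => -(a t i * a t j)) = a t i • fun j => -a t j := by
      ext j
      simp
    rw [hrow', Matrix.det_updateRow_smul, Matrix.det_zero_of_row_eq hk (by
      rw [Matrix.updateRow_self, Matrix.updateRow_ne hk, Matrix.updateRow_self])]
    simp
  · simp

theorem det_updateRow_eq_det_borderedMatrix (K : ℝ → ℝ → ℝ) (u : ℝ → ℝ) {n : ℕ}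
    (x : Fin (n + 1) → ℝ) (k : Fin (n + 1)) :
    ((Matrix.of fun i j => K (x i) (x j)).updateRow k fun j => u (x j)).det =
      (borderedMatrix K u (x k) fun i => x (k.succAbove i)).det := by
  have hx : ∀ j, x (k.cycleRange.symm j) = Matrix.vecCons (x k) (fun i => x (k.succAbove i)) j := by
    intro j
    refine Fin.cases ?_ (fun j => ?_) j
    · simp
    · simp [Fin.cycleRange_symm_succ]
  rw [← Matrix.det_submatrix_equiv_self k.cycleRange.symm]
  congr 1
  ext i j
  refine Fin.cases ?_ (fun i => ?_) i
  · simp [borderedMatrix, hx]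
  · simp [borderedMatrix, hx, Fin.cycleRange_symm_succ]

/-- A family of symmetric kernels with `∂K/∂ξ = -A ⊗ A`, with locally uniform bounds. -/
structure IsRankOneFlow (w : ℝ → ℝ) (K : ℝ → ℝ → ℝ → ℝ) (A A' : ℝ → ℝ → ℝ) : Prop where
  measurable_kernel : ∀ ξ, Measurable (Function.uncurry (K ξ))
  measurable : ∀ ξ, Measurable (A ξ)
  measurable_deriv : ∀ ξ, Measurable (A' ξ)
  symm : ∀ ξ x y, K ξ x y = K ξ y x
  hasDerivAt_kernel : ∀ ξ x y, HasDerivAt (fun s => K s x y) (-(A ξ x * A ξ y)) ξ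
  hasDerivAt : ∀ ξ x, HasDerivAt (fun s => A s x) (A' ξ x) ξ
  locally_bounded : ∀ ξ₀, ∃ C, 0 ≤ C ∧ ∀ ξ ∈ Metric.ball ξ₀ 1,
    (∀ x y, |K ξ x y| ≤ C * w x * w y) ∧ (∀ x, |A ξ x| ≤ C * w x) ∧ ∀ x, |A' ξ x| ≤ C * w x

section RankOneFlow

variable {μ : Measure ℝ} [SigmaFinite μ] {w : ℝ → ℝ} {K : ℝ → ℝ → ℝ → ℝ} {A A' : ℝ → ℝ → ℝ}

theorem abs_sum_det_updateRow_le {n : ℕ} {C : ℝ} (hw : ∀ x, 0 ≤ w x) (hC : 0 ≤ C)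
    {M : Matrix (Fin n) (Fin n) ℝ} {N : Matrix (Fin n) (Fin n) ℝ} {x : Fin n → ℝ}
    (hM : ∀ i j, |M i j| ≤ C * w (x i) * w (x j)) (hN : ∀ i j, |N i j| ≤ C * w (x i) * w (x j)) :
    |∑ i, (M.updateRow i (N i)).det| ≤
      √(n + 1 : ℝ) ^ (n + 1) * (2 * C) ^ n * ∏ i, w (x i) ^ 2 := by
  have hprod : 0 ≤ ∏ i, w (x i) ^ 2 := Finset.prod_nonneg fun i _ => sq_nonneg _
  have hsqrt : √(n : ℝ) ^ n ≤ √(n + 1 : ℝ) ^ (n + 1) := by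
    calc √(n : ℝ) ^ n ≤ √(n + 1 : ℝ) ^ n := by gcongr; linarith
      _ ≤ √(n + 1 : ℝ) ^ (n + 1) :=
        pow_le_pow_right₀ (Real.one_le_sqrt.mpr (by linarith [n.cast_nonneg (α := ℝ)])) n.le_succ
  have hn : (n : ℝ) ≤ 2 ^ n := by exact_mod_cast n.lt_two_pow_self.le
  calc |∑ i, (M.updateRow i (N i)).det| ≤ ∑ i, |(M.updateRow i (N i)).det| :=
        Finset.abs_sum_le_sum_abs _ _
    _ ≤ ∑ _i : Fin n, √(n : ℝ) ^ n * C ^ n * ∏ i, w (x i) ^ 2 := by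
        refine Finset.sum_le_sum fun i _ => abs_det_kernel_le hw hC fun k j => ?_
        by_cases hk : k = i
        · subst hk
          simpa using hN k j
        · simpa [Matrix.updateRow_ne hk] using hM k j
    _ = n * (√(n : ℝ) ^ n * C ^ n * ∏ i, w (x i) ^ 2) := by simp
    _ ≤ 2 ^ n * (√(n + 1 : ℝ) ^ (n + 1) * C ^ n * ∏ i, w (x i) ^ 2) := by gcongr
    _ = _ := by rw [mul_pow]; ring

theorem measurable_sum_det_updateRow {n : ℕ} {k : ℝ → ℝ → ℝ} (hk : Measurable (Function.uncurry k))
    {r : ℝ → ℝ → ℝ} (hr : Measurable (Function.uncurry r)) :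
    Measurable fun x : Fin n → ℝ =>
      ∑ i, ((Matrix.of fun i j => k (x i) (x j)).updateRow i fun j => r (x i) (x j)).det := by
  refine Finset.measurable_sum _ fun i _ => Measurable.det_of fun l j => ?_
  have hp : ∀ l j : Fin n, Measurable fun x : Fin n → ℝ => (x l, x j) := fun l j =>
    (measurable_pi_apply l).prodMk (measurable_pi_apply j)
  by_cases hl : l = i
  · subst hl
    have := hr.comp (hp l j)
    simpa [Function.comp_def, Function.uncurry] using this
  · have := hk.comp (hp l j)
    simpa [Matrix.updateRow_ne hl, Function.comp_def, Function.uncurry] using this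

theorem IsRankOneFlow.iteratedDeriv_two (h : IsRankOneFlow w K A A') (hw : IsWeight μ w) (ξ : ℝ) :
    iteratedDeriv 2 (fun s => ∑' n, fredholmTerm μ (K s) n) ξ =
      ∑' n : ℕ, (-1) ^ n / n.factorial * ∫ x : Fin n → ℝ,
        ∑ i, ((Matrix.of fun i j => K ξ (x i) (x j)).updateRow i
          fun j => -(A' ξ (x i) * A ξ (x j) + A ξ (x i) * A' ξ (x j))).det
          ∂Measure.pi fun _ => μ := by
  set G₀ : (n : ℕ) → ℝ → (Fin n → ℝ) → ℝ := fun n s x =>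
    (Matrix.of fun i j => K s (x i) (x j)).det with hG₀
  set G₁ : (n : ℕ) → ℝ → (Fin n → ℝ) → ℝ := fun n s x =>
    ∑ i, ((Matrix.of fun i j => K s (x i) (x j)).updateRow i
      fun j => -(A s (x i) * A s (x j))).det with hG₁
  set G₂ : (n : ℕ) → ℝ → (Fin n → ℝ) → ℝ := fun n s x =>
    ∑ i, ((Matrix.of fun i j => K s (x i) (x j)).updateRow i
      fun j => -(A' s (x i) * A s (x j) + A s (x i) * A' s (x j))).det with hG₂
  have hd₀ : ∀ n s x, HasDerivAt (fun s => G₀ n s x) (G₁ n s x) s := fun n s x =>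
    Matrix.hasDerivAt_det (M := fun s => Matrix.of fun i j => K s (x i) (x j))
      (M' := fun i j => -(A s (x i) * A s (x j))) fun i j => h.hasDerivAt_kernel s (x i) (x j)
  have hd₁ : ∀ n s x, HasDerivAt (fun s => G₁ n s x) (G₂ n s x) s := fun n s x =>
    Matrix.hasDerivAt_sum_det_updateRow (M := fun s => Matrix.of fun i j => K s (x i) (x j))
      (a := fun s i => A s (x i)) (fun i j => h.hasDerivAt_kernel s (x i) (x j))
      fun i => h.hasDerivAt s (x i)
  have hfst : ∀ {f : ℝ → ℝ}, Measurable f → Measurable fun p : ℝ × ℝ => f p.1 := fun hf =>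
    hf.comp measurable_fst
  have hsnd : ∀ {f : ℝ → ℝ}, Measurable f → Measurable fun p : ℝ × ℝ => f p.2 := fun hf =>
    hf.comp measurable_snd
  have hm₀ : ∀ n s, Measurable (G₀ n s) := fun n s =>
    measurable_det_kernel (h.measurable_kernel s) n
  have hm₁ : ∀ n s, Measurable (G₁ n s) := fun n s =>
    measurable_sum_det_updateRow (h.measurable_kernel s) (r := fun u v => -(A s u * A s v))
      ((hfst (h.measurable s)).mul (hsnd (h.measurable s))).neg
  have hm₂ : ∀ n s, Measurable (G₂ n s) := fun n s =>
    measurable_sum_det_updateRow (h.measurable_kernel s)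
      (r := fun u v => -(A' s u * A s v + A s u * A' s v))
      (((hfst (h.measurable_deriv s)).mul (hsnd (h.measurable s))).add
        ((hfst (h.measurable s)).mul (hsnd (h.measurable_deriv s)))).neg
  have hbound : ∀ t, ∃ C, ∀ n, ∀ s ∈ Metric.ball t 1, ∀ x : Fin n → ℝ,
      |G₀ n s x| ≤ √(n + 1 : ℝ) ^ (n + 1) * C ^ n * ∏ i, w (x i) ^ 2 ∧
      |G₁ n s x| ≤ √(n + 1 : ℝ) ^ (n + 1) * C ^ n * ∏ i, w (x i) ^ 2 ∧
      |G₂ n s x| ≤ √(n + 1 : ℝ) ^ (n + 1) * C ^ n * ∏ i, w (x i) ^ 2 := by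
    intro t
    obtain ⟨C, hC, hb⟩ := h.locally_bounded t
    refine ⟨2 * (C + 2 * C ^ 2), fun n s hs x => ?_⟩
    obtain ⟨hK, hA, hA'⟩ := hb s hs
    have hww : ∀ u v, 0 ≤ w u * w v := fun u v => mul_nonneg (hw.nonneg u) (hw.nonneg v)
    have hle : ∀ c u v, c ≤ C + 2 * C ^ 2 → c * (w u * w v) ≤ (C + 2 * C ^ 2) * w u * w v :=
      fun c u v hc => by
        rw [mul_assoc]
        exact mul_le_mul_of_nonneg_right hc (hww u v)
    have hC' : 0 ≤ C + 2 * C ^ 2 := by positivity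
    have hK' : ∀ u v, |K s u v| ≤ (C + 2 * C ^ 2) * w u * w v := fun u v =>
      (hK u v).trans (by rw [mul_assoc C]; exact hle C u v (by nlinarith))
    have hmul : ∀ {a b u v : ℝ}, |a| ≤ C * w u → |b| ≤ C * w v →
        |a * b| ≤ C ^ 2 * (w u * w v) := fun {a b u v} ha hb => by
      rw [abs_mul]
      exact (mul_le_mul ha hb (abs_nonneg _) ((abs_nonneg _).trans ha)).trans (le_of_eq (by ring))
    refine ⟨?_, ?_, ?_⟩
    · refine (abs_det_kernel_le hw.nonneg hC' fun i j => hK' (x i) (x j)).trans ?_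
      have hprod : 0 ≤ ∏ i, w (x i) ^ 2 := Finset.prod_nonneg fun i _ => sq_nonneg _
      have hsqrt : √(n : ℝ) ^ n ≤ √(n + 1 : ℝ) ^ (n + 1) := by
        calc √(n : ℝ) ^ n ≤ √(n + 1 : ℝ) ^ n := by gcongr; linarith
          _ ≤ √(n + 1 : ℝ) ^ (n + 1) := pow_le_pow_right₀
            (Real.one_le_sqrt.mpr (by linarith [n.cast_nonneg (α := ℝ)])) n.le_succ
      gcongr
      linarith
    · refine abs_sum_det_updateRow_le hw.nonneg hC' (N := fun i j => -(A s (x i) * A s (x j)))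
        (fun i j => hK' (x i) (x j)) fun i j => ?_
      rw [abs_neg]
      exact (hmul (hA _) (hA _)).trans (hle _ _ _ (by nlinarith))
    · refine abs_sum_det_updateRow_le hw.nonneg hC'
        (N := fun i j => -(A' s (x i) * A s (x j) + A s (x i) * A' s (x j)))
        (fun i j => hK' (x i) (x j)) fun i j => ?_
      rw [abs_neg]
      refine (abs_add_le _ _).trans ((add_le_add (hmul (hA' _) (hA _))
        (hmul (hA _) (hA' _))).trans (le_trans (le_of_eq ?_) (hle (2 * C ^ 2) _ _ (by linarith))))
      ring
  have hF₁ : ∀ t, HasDerivAt (fun s => ∑' n, fredholmTerm μ (K s) n)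
      (∑' n : ℕ, (-1) ^ n / n.factorial * ∫ x, G₁ n t x ∂Measure.pi fun _ => μ) t := by
    intro t
    obtain ⟨C, hC⟩ := hbound t
    exact hasDerivAt_fredholm_series hw hm₀ hm₁ hd₀ (fun n s hs x => (hC n s hs x).1)
      (fun n s hs x => (hC n s hs x).2.1)
  have hF₂ : HasDerivAt
      (fun t => ∑' n : ℕ, (-1) ^ n / n.factorial * ∫ x, G₁ n t x ∂Measure.pi fun _ => μ)
      (∑' n : ℕ, (-1) ^ n / n.factorial * ∫ x, G₂ n ξ x ∂Measure.pi fun _ => μ) ξ := by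
    obtain ⟨C, hC⟩ := hbound ξ
    exact hasDerivAt_fredholm_series hw hm₁ hm₂ hd₁ (fun n s hs x => (hC n s hs x).2.1)
      (fun n s hs x => (hC n s hs x).2.2)
  rw [iteratedDeriv_succ, iteratedDeriv_one, funext fun t => (hF₁ t).deriv]
  exact hF₂.deriv

/-- The second derivative of a Fredholm determinant along a rank one flow, in terms of bordered
determinants. -/
theorem IsRankOneFlow.integral_sum_det (h : IsRankOneFlow w K A A') (hw : IsWeight μ w) (ξ : ℝ)
    (n : ℕ) :
    ∫ x : Fin (n + 1) → ℝ, ∑ i, ((Matrix.of fun i j => K ξ (x i) (x j)).updateRow i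
        fun j => -(A' ξ (x i) * A ξ (x j) + A ξ (x i) * A' ξ (x j))).det ∂Measure.pi (fun _ => μ) =
      -(2 * (n + 1) * ∫ l, A ξ l * borderedCoeff μ (K ξ) (A' ξ) n l ∂μ) := by
  obtain ⟨C, hC, hb⟩ := h.locally_bounded ξ
  obtain ⟨hK, hA, hA'⟩ := hb ξ (Metric.mem_ball_self one_pos)
  have hdom : IsDominatedKernel w C (K ξ) := ⟨h.measurable_kernel ξ, hK⟩
  have hint := integrable_uncurry_mul_det (μ := μ) (E := C * C) hw hC hdom (h.measurable ξ)
    (v := fun _ => A' ξ) ((h.measurable_deriv ξ).comp measurable_snd) measurable_id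
    (D := fun _ => C) (fun _ => hC) (fun _ x => hA' x) (fun l => by
      calc |A ξ l| * (C * w (id l)) ≤ (C * w l) * (C * w l) :=
            mul_le_mul_of_nonneg_right (hA l) (mul_nonneg hC (hw.nonneg l))
        _ = _ := by ring) n
  have hint' : ∀ k : Fin (n + 1), Integrable (fun x : Fin (n + 1) → ℝ => A ξ (x k) *
      (borderedMatrix (K ξ) (A' ξ) (x k) fun i => x (k.succAbove i)).det)
      (Measure.pi fun _ => μ) := fun k => integrable_pi_succAbove k hint
  have hpt : ∀ x : Fin (n + 1) → ℝ, ∑ i, ((Matrix.of fun i j => K ξ (x i) (x j)).updateRow i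
      fun j => -(A' ξ (x i) * A ξ (x j) + A ξ (x i) * A' ξ (x j))).det =
      -2 * ∑ k, A ξ (x k) *
        (borderedMatrix (K ξ) (A' ξ) (x k) fun i => x (k.succAbove i)).det := by
    intro x
    set M : Matrix (Fin (n + 1)) (Fin (n + 1)) ℝ := Matrix.of fun i j => K ξ (x i) (x j)
    have hM : M.IsSymm := by
      ext i j
      exact h.symm ξ _ _
    have h1 : ∀ i, (M.updateRow i
        fun j => -(A' ξ (x i) * A ξ (x j) + A ξ (x i) * A' ξ (x j))).det =
        -(A' ξ (x i) * (M.updateRow i fun j => A ξ (x j)).det) -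
          A ξ (x i) * (M.updateRow i fun j => A' ξ (x j)).det := by
      intro i
      have : (fun j => -(A' ξ (x i) * A ξ (x j) + A ξ (x i) * A' ξ (x j))) =
          (-A' ξ (x i)) • (fun j => A ξ (x j)) + (-A ξ (x i)) • fun j => A' ξ (x j) := by
        ext j
        simp only [Pi.add_apply, Pi.smul_apply, smul_eq_mul]
        ring
      rw [this, Matrix.det_updateRow_add, Matrix.det_updateRow_smul, Matrix.det_updateRow_smul]
      ring
    simp only [h1, Finset.sum_sub_distrib, Finset.sum_neg_distrib]
    rw [hM.sum_mul_det_updateRow (fun i => A' ξ (x i)) fun j => A ξ (x j)]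
    simp only [← det_updateRow_eq_det_borderedMatrix]
    ring
  simp only [hpt]
  rw [integral_const_mul, integral_finsetSum _ fun k _ => hint' k]
  have hk : ∀ k : Fin (n + 1), ∫ x : Fin (n + 1) → ℝ, A ξ (x k) *
      (borderedMatrix (K ξ) (A' ξ) (x k) fun i => x (k.succAbove i)).det ∂Measure.pi (fun _ => μ) =
      ∫ l, A ξ l * borderedCoeff μ (K ξ) (A' ξ) n l ∂μ := by
    intro k
    refine (integral_pi_succAbove k hint).trans ?_
    simp only [integral_const_mul, id_eq]
    rfl
  simp only [hk, Finset.sum_const, Finset.card_univ, Fintype.card_fin, nsmul_eq_mul]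
  push_cast
  ring

theorem IsRankOneFlow.iteratedDeriv_two_eq_tsum (h : IsRankOneFlow w K A A') (hw : IsWeight μ w)
    (ξ : ℝ) :
    iteratedDeriv 2 (fun s => ∑' n, fredholmTerm μ (K s) n) ξ =
      2 * ∑' n : ℕ, ∫ l, A ξ l * borderedTerm μ (K ξ) (A' ξ) n l ∂μ := by
  rw [h.iteratedDeriv_two hw, ← tsum_mul_left]
  refine (Function.Injective.tsum_eq (g := Nat.succ) Nat.succ_injective ?_).symm.trans ?_
  · intro n hn
    cases n with
    | zero => simp at hn
    | succ n => exact ⟨n, rfl⟩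
  · refine tsum_congr fun n => ?_
    rw [Nat.succ_eq_add_one, h.integral_sum_det hw]
    simp only [borderedTerm, mul_left_comm (A ξ _), integral_const_mul]
    rw [Nat.factorial_succ, pow_succ]
    push_cast
    have : (n : ℝ) + 1 ≠ 0 := by positivity
    have : (n.factorial : ℝ) ≠ 0 := by positivity
    field_simp

/-- `F'' / (2 F)` for a Fredholm determinant `F` along a rank one flow, in terms of the resolvent
kernel `R`. -/
theorem IsRankOneFlow.iteratedDeriv_two_eq {R : ℝ → ℝ → ℝ} {ξ : ℝ} (h : IsRankOneFlow w K A A')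
    (hw : IsWeight μ w)
    (hRm : ∀ y, AEStronglyMeasurable (fun l => R l y) μ)
    (hRb : ∀ y, ∃ B, ∀ l, |R l y| ≤ B * w l)
    (hR : ∀ a y, R a y = K ξ a y + ∫ l, K ξ a l * R l y ∂μ) :
    ∑' n, fredholmTerm μ (K ξ) n ≠ 0 ∧
      iteratedDeriv 2 (fun s => ∑' n, fredholmTerm μ (K s) n) ξ =
        2 * ((∑' n, fredholmTerm μ (K ξ) n) * ((∫ l, A' ξ l * A ξ l ∂μ) +
          ∫ l, ∫ m, R l m * A' ξ m * A ξ l ∂μ ∂μ)) := by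
  obtain ⟨C, hC, hb⟩ := h.locally_bounded ξ
  obtain ⟨hK, hA, hA'⟩ := hb ξ (Metric.mem_ball_self one_pos)
  have hdom : IsDominatedKernel w C (K ξ) := ⟨h.measurable_kernel ξ, hK⟩
  obtain ⟨hne, hmin⟩ := fredholm_resolvent hw hC hdom (h.symm ξ) hRm hRb hR
  refine ⟨hne, ?_⟩
  rw [h.iteratedDeriv_two_eq_tsum hw]
  congr 1
  set d := fredholmTerm μ (K ξ)
  set D : ℕ → ℝ → ℝ → ℝ := fun n a y => borderedTerm μ (K ξ) (K ξ a) n y with hD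
  set W := ∫ x, w x ^ 2 ∂μ
  have hβ := summable_fredholmMajorant (C * W)
  have hDb : ∀ n a y, |D n a y| ≤ C * w a * w y * fredholmMajorant (C * W) n := fun n a y =>
    abs_borderedTerm_le hw hC (mul_nonneg hC (hw.nonneg a)) hdom (hK a) n y
  have hDm : ∀ n, Measurable (Function.uncurry (D n)) := fun n =>
    measurable_borderedTerm hdom.measurable hdom.measurable n
  have hinner : ∀ l, HasSum (fun n => ∫ m, A' ξ m * D n m l ∂μ)
      (∫ m, ∑' n, A' ξ m * D n m l ∂μ) := fun l =>
    hasSum_integral_of_majorant (g := fun m => C * C * w l * w m ^ 2)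
      (fun n => ((h.measurable_deriv ξ).mul
        ((hDm n).comp measurable_prodMk_right)).aestronglyMeasurable)
      (hw.integrable_sq.const_mul _) hβ fun n m => by
        rw [abs_mul]
        exact (mul_le_mul (hA' m) (hDb n m l) (abs_nonneg _)
          ((abs_nonneg _).trans (hA' m))).trans (le_of_eq (by ring))
  have hβ0 := fredholmMajorant_nonneg (mul_nonneg hC
    (integral_nonneg fun x => sq_nonneg (w x)) : 0 ≤ C * W)
  have hinnerb : ∀ n l, |∫ m, A' ξ m * D n m l ∂μ| ≤
      C * C * W * w l * fredholmMajorant (C * W) n := by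
    intro n l
    have : C * C * W * w l * fredholmMajorant (C * W) n =
        ∫ m, C * C * w l * fredholmMajorant (C * W) n * w m ^ 2 ∂μ := by
      rw [integral_const_mul]; ring
    rw [this]
    refine norm_integral_le_of_norm_le (f := fun m => A' ξ m * D n m l)
      (hw.integrable_sq.const_mul _) (Filter.Eventually.of_forall fun m => ?_)
    rw [norm_mul, Real.norm_eq_abs, Real.norm_eq_abs]
    exact (mul_le_mul (hA' m) (hDb n m l) (abs_nonneg _)
      ((abs_nonneg _).trans (hA' m))).trans (le_of_eq (by ring))
  have hinnerm : ∀ n, Measurable fun l => ∫ m, A' ξ m * D n m l ∂μ := fun n => by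
    have : Measurable (Function.uncurry fun l m => A' ξ m * D n m l) :=
      ((h.measurable_deriv ξ).comp measurable_snd).mul
        ((hDm n).comp (measurable_snd.prodMk measurable_fst))
    exact this.stronglyMeasurable.integral_prod_right.measurable
  have houterb : ∀ n l, |A ξ l * ∫ m, A' ξ m * D n m l ∂μ| ≤
      C * C * C * W * w l ^ 2 * fredholmMajorant (C * W) n := fun n l => by
    rw [abs_mul]
    exact (mul_le_mul (hA l) (hinnerb n l) (abs_nonneg _)
      ((abs_nonneg _).trans (hA l))).trans (le_of_eq (by ring))
  have houter := hasSum_integral_of_majorant (ν := μ)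
    (f := fun n l => A ξ l * ∫ m, A' ξ m * D n m l ∂μ)
    (fun n => ((h.measurable ξ).mul (hinnerm n)).aestronglyMeasurable)
    (hw.integrable_sq.const_mul (C * C * C * W)) hβ houterb
  have hAA : Integrable (fun l => A' ξ l * A ξ l) μ := by
    refine (hw.integrable_sq.const_mul (C * C)).mono'
      ((h.measurable_deriv ξ).mul (h.measurable ξ)).aestronglyMeasurable
      (Filter.Eventually.of_forall fun l => ?_)
    rw [norm_mul, Real.norm_eq_abs, Real.norm_eq_abs]
    exact (mul_le_mul (hA' l) (hA l) (abs_nonneg _)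
      ((abs_nonneg _).trans (hA' l))).trans (le_of_eq (by ring))
  have hdsum : Summable d :=
    Summable.of_norm_bounded hβ fun n => abs_fredholmTerm_le hw hC hdom n
  have hzero : ∫ l, A ξ l * borderedTerm μ (K ξ) (A' ξ) 0 l ∂μ =
      d 0 * ∫ l, A' ξ l * A ξ l ∂μ := by
    simp [d, borderedTerm, fredholmTerm, borderedCoeff_zero, fredholmCoeff_zero, mul_comm]
  have hsucc : ∀ n, ∫ l, A ξ l * borderedTerm μ (K ξ) (A' ξ) (n + 1) l ∂μ =
      d (n + 1) * (∫ l, A' ξ l * A ξ l ∂μ) + ∫ l, A ξ l * ∫ m, A' ξ m * D n m l ∂μ ∂μ := by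
    intro n
    have hi : Integrable (fun l => A ξ l * ∫ m, A' ξ m * D n m l ∂μ) μ :=
      ((hw.integrable_sq.const_mul (C * C * C * W)).mul_const _).mono'
        ((h.measurable ξ).mul (hinnerm n)).aestronglyMeasurable
        (Filter.Eventually.of_forall (houterb n))
    rw [← integral_const_mul, ← integral_add (hAA.const_mul _) hi]
    refine integral_congr_ae (Filter.Eventually.of_forall fun l => ?_)
    simp only [borderedTerm_succ hw hC hdom (h.measurable_deriv ξ) hA' n l]
    ring
  have hS : HasSum (fun n => ∫ l, A ξ l * borderedTerm μ (K ξ) (A' ξ) n l ∂μ)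
      (((∑' n, d n) * ∫ l, A' ξ l * A ξ l ∂μ) +
        ∫ l, ∑' n, A ξ l * ∫ m, A' ξ m * D n m l ∂μ ∂μ) := by
    have h0 := (hasSum_nat_add_iff' 1).mpr (hdsum.hasSum.mul_right (∫ l, A' ξ l * A ξ l ∂μ))
    refine (hasSum_nat_add_iff' 1).mp ?_
    simp only [hsucc]
    have := h0.add houter
    simp only [Finset.range_one, Finset.sum_singleton, hzero] at this ⊢
    convert this using 1
    ring
  rw [hS.tsum_eq, mul_add]
  congr 1
  rw [← integral_const_mul]
  refine integral_congr_ae (Filter.Eventually.of_forall fun l => ?_)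
  have hsymmD : ∀ m, ∑' n, D n m l = (∑' n, d n) * R l m := fun m => by
    rw [← hmin l m]
    refine tsum_congr fun n => ?_
    simp only [D, borderedTerm, borderedCoeff_symm (h.symm ξ) n m l]
  simp only [tsum_mul_left, (hinner l).tsum_eq, hsymmD]
  rw [← integral_const_mul, ← integral_const_mul]
  refine integral_congr_ae (Filter.Eventually.of_forall fun m => ?_)
  ring

end RankOneFlow

/-- The moments `∫ wᵏ exp(w³/3 - x w) dt`, `w = 1 + i t`, of the Airy contour integral. -/
noncomputable def airyMoment (k : ℕ) (x : ℝ) : ℂ :=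
  ∫ t : ℝ, (1 + (t : ℂ) * I) ^ k *
    cexp ((1 + (t : ℂ) * I) ^ 3 / 3 - (x : ℂ) * (1 + (t : ℂ) * I))

theorem norm_airyIntegrand_le (k : ℕ) (x t : ℝ) :
    ‖(1 + (t : ℂ) * I) ^ k * cexp ((1 + (t : ℂ) * I) ^ 3 / 3 - (x : ℂ) * (1 + (t : ℂ) * I))‖ ≤
      k.factorial * Real.exp (2 - x) * Real.exp (-(1 / 2) * t ^ 2) := by
  have hre : ((1 + (t : ℂ) * I) ^ 3 / 3 - (x : ℂ) * (1 + (t : ℂ) * I)).re = 1 / 3 - t ^ 2 - x := by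
    have : (1 + (t : ℂ) * I) ^ 3 / 3 - (x : ℂ) * (1 + (t : ℂ) * I) =
        ((1 / 3 - t ^ 2 - x : ℝ) : ℂ) + ((t - t ^ 3 / 3 - x * t : ℝ) : ℂ) * I := by
      push_cast
      linear_combination ((t : ℂ) ^ 2 + (t : ℂ) ^ 3 * I / 3) * I_sq
    rw [this, add_re, ofReal_re, re_ofReal_mul, I_re, mul_zero, add_zero]
  have hw : ‖1 + (t : ℂ) * I‖ ≤ 1 + |t| := by
    refine (norm_add_le _ _).trans ?_
    simp
  have hpow : ‖1 + (t : ℂ) * I‖ ^ k ≤ k.factorial * Real.exp (1 + |t|) := by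
    have h := Real.pow_div_factorial_le_exp (1 + |t|) (by positivity) k
    rw [div_le_iff₀ (by positivity)] at h
    calc ‖1 + (t : ℂ) * I‖ ^ k ≤ (1 + |t|) ^ k := by gcongr
      _ ≤ _ := by linarith
  rw [norm_mul, norm_pow, norm_exp, hre]
  calc ‖1 + (t : ℂ) * I‖ ^ k * Real.exp (1 / 3 - t ^ 2 - x)
      ≤ k.factorial * Real.exp (1 + |t|) * Real.exp (1 / 3 - t ^ 2 - x) := by gcongr
    _ = k.factorial * Real.exp (1 + |t| + (1 / 3 - t ^ 2 - x)) := by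
        rw [mul_assoc, ← Real.exp_add]
    _ ≤ k.factorial * Real.exp (2 - x + -(1 / 2) * t ^ 2) := by
        refine mul_le_mul_of_nonneg_left (Real.exp_le_exp.mpr ?_) (by positivity)
        nlinarith [sq_nonneg (|t| - 1), sq_abs t]
    _ = _ := by rw [mul_assoc, Real.exp_add]

theorem continuous_airyIntegrand (k : ℕ) (x : ℝ) : Continuous fun t : ℝ =>
    (1 + (t : ℂ) * I) ^ k * cexp ((1 + (t : ℂ) * I) ^ 3 / 3 - (x : ℂ) * (1 + (t : ℂ) * I)) := by
  fun_prop

theorem integrable_gaussian_half : Integrable fun t : ℝ => Real.exp (-(1 / 2) * t ^ 2) :=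
  integrable_exp_neg_mul_sq (by norm_num)

theorem integrable_airyIntegrand (k : ℕ) (x : ℝ) : Integrable fun t : ℝ =>
    (1 + (t : ℂ) * I) ^ k * cexp ((1 + (t : ℂ) * I) ^ 3 / 3 - (x : ℂ) * (1 + (t : ℂ) * I)) :=
  (integrable_gaussian_half.const_mul (k.factorial * Real.exp (2 - x))).mono'
    (continuous_airyIntegrand k x).aestronglyMeasurable
    (Filter.Eventually.of_forall fun t => norm_airyIntegrand_le k x t)

theorem norm_airyMoment_le (k : ℕ) : ∃ C, 0 ≤ C ∧ ∀ x, ‖airyMoment k x‖ ≤ C * Real.exp (-x) := by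
  refine ⟨k.factorial * Real.exp 2 * ∫ t : ℝ, Real.exp (-(1 / 2) * t ^ 2), by positivity,
    fun x => ?_⟩
  refine (norm_integral_le_of_norm_le
    (integrable_gaussian_half.const_mul (k.factorial * Real.exp (2 - x)))
    (Filter.Eventually.of_forall fun t => norm_airyIntegrand_le k x t)).trans (le_of_eq ?_)
  rw [integral_const_mul, sub_eq_add_neg, Real.exp_add]
  ring

theorem hasDerivAt_airyMoment (k : ℕ) (x : ℝ) :
    HasDerivAt (airyMoment k) (-airyMoment (k + 1) x) x := by
  have h := hasDerivAt_integral_of_dominated_loc_of_deriv_le (𝕜 := ℝ) (x₀ := x) (μ := volume)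
    (F := fun (x t : ℝ) => (1 + (t : ℂ) * I) ^ k *
      cexp ((1 + (t : ℂ) * I) ^ 3 / 3 - (x : ℂ) * (1 + (t : ℂ) * I)))
    (F' := fun (x t : ℝ) => -((1 + (t : ℂ) * I) ^ (k + 1) *
      cexp ((1 + (t : ℂ) * I) ^ 3 / 3 - (x : ℂ) * (1 + (t : ℂ) * I))))
    (bound := fun t => (k + 1).factorial * Real.exp (2 - (x - 1)) * Real.exp (-(1 / 2) * t ^ 2))
    (Metric.ball_mem_nhds x one_pos)
    (Filter.Eventually.of_forall fun s => (continuous_airyIntegrand k s).aestronglyMeasurable)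
    (integrable_airyIntegrand k x)
    (continuous_airyIntegrand (k + 1) x).neg.aestronglyMeasurable
    (Filter.Eventually.of_forall fun t s hs => ?_)
    (integrable_gaussian_half.const_mul _)
    (Filter.Eventually.of_forall fun t s _ => ?_)
  · refine h.2.congr_deriv ?_
    rw [integral_neg]
    rfl
  · rw [norm_neg]
    refine (norm_airyIntegrand_le (k + 1) s t).trans ?_
    have : x - 1 ≤ s := by
      rw [Metric.mem_ball, Real.dist_eq] at hs
      linarith [(abs_lt.mp hs).1]
    gcongr
  · have h1 : HasDerivAt (fun s : ℝ => (1 + (t : ℂ) * I) ^ 3 / 3 - (s : ℂ) * (1 + (t : ℂ) * I))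
        (-(1 * (1 + (t : ℂ) * I))) s :=
      (((hasDerivAt_id s).ofReal_comp).mul_const _).const_sub _
    refine (h1.cexp.const_mul _).congr_deriv ?_
    ring

theorem airyMoment_two (x : ℝ) : airyMoment 2 x = x * airyMoment 0 x := by
  have hd : ∀ t : ℝ, HasDerivAt
      (fun t : ℝ => cexp ((1 + (t : ℂ) * I) ^ 3 / 3 - (x : ℂ) * (1 + (t : ℂ) * I)))
      (I * ((1 + (t : ℂ) * I) ^ 2 *
          cexp ((1 + (t : ℂ) * I) ^ 3 / 3 - (x : ℂ) * (1 + (t : ℂ) * I)) -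
        x * ((1 + (t : ℂ) * I) ^ 0 *
          cexp ((1 + (t : ℂ) * I) ^ 3 / 3 - (x : ℂ) * (1 + (t : ℂ) * I))))) t := by
    intro t
    have h1 : HasDerivAt (fun t : ℝ => 1 + (t : ℂ) * I) (1 * I) t :=
      (((hasDerivAt_id t).ofReal_comp).mul_const I).const_add 1
    refine (((h1.pow 3).div_const 3).sub (h1.const_mul (x : ℂ))).cexp.congr_deriv ?_
    simp only [Pi.sub_apply, Pi.pow_apply]
    push_cast
    ring
  have hi := ((integrable_airyIntegrand 2 x).sub
    ((integrable_airyIntegrand 0 x).const_mul (x : ℂ))).const_mul I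
  have h0 : Integrable fun t : ℝ =>
      cexp ((1 + (t : ℂ) * I) ^ 3 / 3 - (x : ℂ) * (1 + (t : ℂ) * I)) := by
    simpa using integrable_airyIntegrand 0 x
  have h := integral_eq_zero_of_hasDerivAt_of_integrable hd hi h0
  rw [integral_const_mul, integral_sub (integrable_airyIntegrand 2 x)
    ((integrable_airyIntegrand 0 x).const_mul (x : ℂ)), integral_const_mul] at h
  exact sub_eq_zero.mp ((mul_eq_zero.mp h).resolve_left I_ne_zero)

theorem Ai_eq (x : ℝ) : Ai x = (2 * Real.pi)⁻¹ * (airyMoment 0 x).re := by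
  rw [Ai, integral_mul_const, ← re_ofReal_mul]
  congr 1
  simp only [airyMoment, pow_zero, one_mul]
  have : (Real.pi : ℂ) ≠ 0 := by exact_mod_cast Real.pi_ne_zero
  have := I_ne_zero
  push_cast
  field_simp

theorem hasDerivAt_Ai' (x : ℝ) :
    HasDerivAt Ai (-((2 * Real.pi)⁻¹ * (airyMoment 1 x).re)) x := by
  have h : HasDerivAt (fun s => (airyMoment 0 s).re) ((-airyMoment 1 x).re) x :=
    (reCLM.hasFDerivAt.comp_hasDerivAt x (hasDerivAt_airyMoment 0 x))
  rw [funext Ai_eq]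
  refine (h.const_mul _).congr_deriv ?_
  simp

theorem deriv_Ai (x : ℝ) : deriv Ai x = -((2 * Real.pi)⁻¹ * (airyMoment 1 x).re) :=
  (hasDerivAt_Ai' x).deriv

theorem hasDerivAt_Ai (x : ℝ) : HasDerivAt Ai (deriv Ai x) x :=
  (hasDerivAt_Ai' x).differentiableAt.hasDerivAt

/-- The Airy equation. -/
theorem hasDerivAt_deriv_Ai (x : ℝ) : HasDerivAt (deriv Ai) (x * Ai x) x := by
  have h : HasDerivAt (fun s => (airyMoment 1 s).re) ((-airyMoment 2 x).re) x :=
    (reCLM.hasFDerivAt.comp_hasDerivAt x (hasDerivAt_airyMoment 1 x))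
  rw [funext deriv_Ai]
  refine (h.const_mul _).neg.congr_deriv ?_
  rw [airyMoment_two, Ai_eq, neg_re, re_ofReal_mul]
  ring

theorem abs_Ai_le : ∃ C, 0 ≤ C ∧ ∀ x, |Ai x| ≤ C * Real.exp (-x) ∧
    |deriv Ai x| ≤ C * Real.exp (-x) := by
  obtain ⟨C₀, h₀, hC₀⟩ := norm_airyMoment_le 0
  obtain ⟨C₁, h₁, hC₁⟩ := norm_airyMoment_le 1
  have hpi : 0 ≤ (2 * Real.pi)⁻¹ := by positivity
  have key : ∀ {c : ℂ} {D : ℝ} {x : ℝ}, ‖c‖ ≤ D * Real.exp (-x) → D ≤ C₀ + C₁ →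
      (2 * Real.pi)⁻¹ * |c.re| ≤ (2 * Real.pi)⁻¹ * (C₀ + C₁) * Real.exp (-x) := by
    intro c D x hc hD
    rw [mul_assoc]
    exact mul_le_mul_of_nonneg_left ((abs_re_le_norm c).trans (hc.trans
      (mul_le_mul_of_nonneg_right hD (Real.exp_nonneg _)))) hpi
  refine ⟨(2 * Real.pi)⁻¹ * (C₀ + C₁), by positivity, fun x => ⟨?_, ?_⟩⟩
  · rw [Ai_eq, abs_mul, abs_of_nonneg hpi]
    exact key (hC₀ x) (by linarith)
  · rw [deriv_Ai, abs_neg, abs_mul, abs_of_nonneg hpi]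
    exact key (hC₁ x) (by linarith)

theorem continuous_Ai : Continuous Ai :=
  continuous_iff_continuousAt.mpr fun x => (hasDerivAt_Ai x).continuousAt

theorem continuous_deriv_Ai : Continuous (deriv Ai) :=
  continuous_iff_continuousAt.mpr fun x => (hasDerivAt_deriv_Ai x).continuousAt

theorem integrableOn_Ioi_of_abs_le_exp {f : ℝ → ℝ} (hf : Continuous f) {M : ℝ}
    (h : ∀ s, 0 < s → |f s| ≤ M * Real.exp (-s)) : IntegrableOn f (Set.Ioi 0) := by
  have h1 : IntegrableOn (fun s : ℝ => M * Real.exp (-s)) (Set.Ioi 0) :=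
    (integrableOn_exp_neg_Ioi 0).const_mul M
  exact h1.mono' hf.aestronglyMeasurable.restrict
    ((ae_restrict_iff' measurableSet_Ioi).mpr (Filter.Eventually.of_forall h))

theorem abs_setIntegral_Ioi_le_of_abs_le_exp {f : ℝ → ℝ} {M : ℝ}
    (h : ∀ s, 0 < s → |f s| ≤ M * Real.exp (-s)) : |∫ s in Set.Ioi 0, f s| ≤ M := by
  have h1 : IntegrableOn (fun s : ℝ => M * Real.exp (-s)) (Set.Ioi 0) :=
    (integrableOn_exp_neg_Ioi 0).const_mul M
  refine (norm_integral_le_of_norm_le (f := f) h1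
    ((ae_restrict_iff' measurableSet_Ioi).mpr (Filter.Eventually.of_forall h))).trans ?_
  rw [integral_const_mul, integral_exp_neg_Ioi_zero, mul_one]

theorem tendsto_zero_of_abs_le_exp {f : ℝ → ℝ} {M : ℝ}
    (h : ∀ s, 0 < s → |f s| ≤ M * Real.exp (-s)) : Filter.Tendsto f Filter.atTop (nhds 0) := by
  refine squeeze_zero_norm' ((Filter.eventually_gt_atTop 0).mono h) ?_
  simpa using Real.tendsto_exp_neg_atTop_nhds_zero.const_mul M

theorem abs_mul_le_of_abs_le_exp {p q C a b s : ℝ} (hp : |p| ≤ C * Real.exp (-(a + s)))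
    (hq : |q| ≤ C * Real.exp (-(b + s))) (hs : 0 < s) :
    |p * q| ≤ C ^ 2 * Real.exp (-a) * Real.exp (-b) * Real.exp (-s) := by
  rw [abs_mul]
  calc |p| * |q| ≤ (C * Real.exp (-(a + s))) * (C * Real.exp (-(b + s))) :=
        mul_le_mul hp hq (abs_nonneg _) ((abs_nonneg _).trans hp)
    _ = C ^ 2 * Real.exp (-a) * Real.exp (-b) * Real.exp (-s) * Real.exp (-s) := by
        rw [neg_add, neg_add, Real.exp_add, Real.exp_add]; ring
    _ ≤ C ^ 2 * Real.exp (-a) * Real.exp (-b) * Real.exp (-s) * 1 := by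
        have : Real.exp (-s) ≤ 1 := Real.exp_le_one_iff.mpr (by linarith)
        gcongr
    _ = _ := mul_one _

theorem integrableOn_Ai_mul_Ai (a b : ℝ) :
    IntegrableOn (fun s => Ai (a + s) * Ai (b + s)) (Set.Ioi 0) := by
  obtain ⟨C, -, hC⟩ := abs_Ai_le
  have := continuous_Ai
  exact integrableOn_Ioi_of_abs_le_exp (by fun_prop) fun s hs =>
    abs_mul_le_of_abs_le_exp (hC _).1 (hC _).1 hs

theorem abs_KAi_le : ∃ C, 0 ≤ C ∧ ∀ ξ v l,
    |KAi ξ v l| ≤ C * Real.exp (-(ξ + v)) * Real.exp (-(ξ + l)) := by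
  obtain ⟨C, -, hC⟩ := abs_Ai_le
  exact ⟨C ^ 2, sq_nonneg C, fun ξ v l => abs_setIntegral_Ioi_le_of_abs_le_exp fun s hs =>
    abs_mul_le_of_abs_le_exp (hC _).1 (hC _).1 hs⟩

theorem KAi_symm (ξ v l : ℝ) : KAi ξ v l = KAi ξ l v := by
  simp only [KAi, mul_comm]

theorem measurable_KAi (ξ : ℝ) : Measurable (Function.uncurry (KAi ξ)) := by
  have := continuous_Ai
  have h : Continuous (Function.uncurry fun (p : ℝ × ℝ) (s : ℝ) =>
      Ai (ξ + p.1 + s) * Ai (ξ + p.2 + s)) := by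
    simp only [Function.uncurry_def]
    fun_prop
  exact (h.stronglyMeasurable.integral_prod_right (ν := volume.restrict (Set.Ioi 0))).measurable

/-- The Christoffel–Darboux form of the Airy kernel. -/
theorem sub_mul_KAi (ξ v l : ℝ) : (v - l) * KAi ξ v l =
    Ai (ξ + v) * deriv Ai (ξ + l) - deriv Ai (ξ + v) * Ai (ξ + l) := by
  obtain ⟨C, -, hC⟩ := abs_Ai_le
  set a := ξ + v
  set b := ξ + l
  have hab : v - l = a - b := by simp [a, b]
  have hd : ∀ s ∈ Set.Ici (0 : ℝ), HasDerivAt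
      (fun s => Ai (a + s) * deriv Ai (b + s) - deriv Ai (a + s) * Ai (b + s))
      (-((a - b) * (Ai (a + s) * Ai (b + s)))) s := by
    intro s _
    have h1 : ∀ c, HasDerivAt (fun s => Ai (c + s)) (deriv Ai (c + s)) s := fun c =>
      (hasDerivAt_Ai (c + s)).comp_const_add c s
    have h2 : ∀ c, HasDerivAt (fun s => deriv Ai (c + s)) ((c + s) * Ai (c + s)) s := fun c =>
      (hasDerivAt_deriv_Ai (c + s)).comp_const_add c s
    refine (((h1 a).mul (h2 b)).sub ((h2 a).mul (h1 b))).congr_deriv ?_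
    ring
  have ht : Filter.Tendsto
      (fun s => Ai (a + s) * deriv Ai (b + s) - deriv Ai (a + s) * Ai (b + s))
      Filter.atTop (nhds (0 - 0)) :=
    (tendsto_zero_of_abs_le_exp fun s hs => abs_mul_le_of_abs_le_exp (hC _).1 (hC _).2 hs).sub
      (tendsto_zero_of_abs_le_exp fun s hs => abs_mul_le_of_abs_le_exp (hC _).2 (hC _).1 hs)
  have h := integral_Ioi_of_hasDerivAt_of_tendsto' hd
    ((integrableOn_Ai_mul_Ai a b).const_mul (a - b)).neg ht
  rw [integral_neg, integral_const_mul] at h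
  simp only [add_zero] at h
  rw [KAi, hab]
  linarith

theorem hasDerivAt_KAi (ξ v l : ℝ) :
    HasDerivAt (fun s => KAi s v l) (-(Ai (ξ + v) * Ai (ξ + l))) ξ := by
  obtain ⟨C, -, hC⟩ := abs_Ai_le
  have hcont := continuous_Ai
  have hcont' := continuous_deriv_Ai
  have hA : ∀ c s x : ℝ, HasDerivAt (fun x => Ai (x + c + s)) (deriv Ai (x + c + s)) x := by
    intro c s x
    simpa only [add_assoc] using (hasDerivAt_Ai (x + (c + s))).comp_add_const x (c + s)
  set F' : ℝ → ℝ → ℝ := fun x s => deriv Ai (x + v + s) * Ai (x + l + s) +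
    Ai (x + v + s) * deriv Ai (x + l + s)
  have hF'b : ∀ x s, 0 < s → |F' x s| ≤
      2 * C ^ 2 * Real.exp (-(x + v)) * Real.exp (-(x + l)) * Real.exp (-s) := fun x s hs =>
    (abs_add_le _ _).trans ((add_le_add (abs_mul_le_of_abs_le_exp (hC _).2 (hC _).1 hs)
      (abs_mul_le_of_abs_le_exp (hC _).1 (hC _).2 hs)).trans (le_of_eq (by ring)))
  have hmain := hasDerivAt_integral_of_dominated_loc_of_deriv_le (𝕜 := ℝ) (x₀ := ξ)
    (μ := volume.restrict (Set.Ioi 0)) (F := fun x s => Ai (x + v + s) * Ai (x + l + s))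
    (F' := F')
    (bound := fun s =>
      2 * C ^ 2 * Real.exp (-(ξ - 1 + v)) * Real.exp (-(ξ - 1 + l)) * Real.exp (-s))
    (Metric.ball_mem_nhds ξ one_pos)
    (Filter.Eventually.of_forall fun x =>
      (by fun_prop : Continuous fun s => Ai (x + v + s) * Ai (x + l + s)).aestronglyMeasurable)
    (integrableOn_Ai_mul_Ai (ξ + v) (ξ + l))
    (by fun_prop : Continuous (F' ξ)).aestronglyMeasurable
    ((ae_restrict_iff' measurableSet_Ioi).mpr (Filter.Eventually.of_forall fun s hs x hx => by
      refine (hF'b x s hs).trans ?_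
      have : ξ - 1 ≤ x := by
        rw [Metric.mem_ball, Real.dist_eq] at hx
        linarith [(abs_lt.mp hx).1]
      gcongr))
    ((integrableOn_exp_neg_Ioi 0).const_mul _)
    (Filter.Eventually.of_forall fun s x _ => (hA v s x).mul (hA l s x))
  refine hmain.2.congr_deriv ?_
  have hs : ∀ c s, HasDerivAt (fun s => Ai (c + s)) (deriv Ai (c + s)) s := fun c s =>
    (hasDerivAt_Ai (c + s)).comp_const_add c s
  have h := integral_Ioi_of_hasDerivAt_of_tendsto' (a := 0)
    (f := fun s => Ai (ξ + v + s) * Ai (ξ + l + s)) (f' := F' ξ)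
    (fun s _ => (hs (ξ + v) s).mul (hs (ξ + l) s)) hmain.1
    (tendsto_zero_of_abs_le_exp fun s hs => abs_mul_le_of_abs_le_exp (hC _).1 (hC _).1 hs)
  rw [h]
  simp

/-- A weight dominating the Airy kernel. -/
noncomputable def airyWeight (x : ℝ) : ℝ := (2 + |x|) * Real.exp (-x)

theorem exp_neg_le_airyWeight (x : ℝ) : Real.exp (-x) ≤ airyWeight x := by
  have := Real.exp_pos (-x)
  have := abs_nonneg x
  unfold airyWeight
  nlinarith

theorem continuous_airyWeight : Continuous airyWeight := by
  unfold airyWeight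
  fun_prop

theorem isWeight_airyWeight : IsWeight (volume.restrict (Set.Ioi 0)) airyWeight := by
  refine ⟨continuous_airyWeight.measurable, fun x =>
    (Real.exp_nonneg _).trans (exp_neg_le_airyWeight x), ?_⟩
  refine integrableOn_Ioi_of_abs_le_exp (M := 16) (continuous_airyWeight.pow 2) fun s hs => ?_
  have h1 : 2 + s ≤ 4 * Real.exp (s / 2) := by linarith [Real.add_one_le_exp (s / 2)]
  have h2 : (2 + s) ^ 2 ≤ 16 * Real.exp s := by
    calc (2 + s) ^ 2 ≤ (4 * Real.exp (s / 2)) ^ 2 := by gcongr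
      _ = 16 * Real.exp s := by
        rw [mul_pow, ← Real.exp_nat_mul]
        norm_num
        ring_nf
  rw [abs_of_nonneg (sq_nonneg _), airyWeight, abs_of_pos hs, mul_pow]
  calc (2 + s) ^ 2 * Real.exp (-s) ^ 2 ≤ 16 * Real.exp s * Real.exp (-s) ^ 2 := by gcongr
    _ = 16 * Real.exp (-s) * (Real.exp s * Real.exp (-s)) := by ring
    _ = 16 * Real.exp (-s) := by rw [← Real.exp_add]; simp

theorem isRankOneFlow_KAi :
    IsRankOneFlow airyWeight KAi (fun ξ x => Ai (ξ + x)) (fun ξ x => deriv Ai (ξ + x)) where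
  measurable_kernel := measurable_KAi
  measurable ξ := (continuous_Ai.comp (continuous_const.add continuous_id)).measurable
  measurable_deriv ξ := (continuous_deriv_Ai.comp (continuous_const.add continuous_id)).measurable
  symm := KAi_symm
  hasDerivAt_kernel := hasDerivAt_KAi
  hasDerivAt ξ x := (hasDerivAt_Ai (ξ + x)).comp_add_const ξ x
  locally_bounded ξ₀ := by
    obtain ⟨C₁, h₁, hC₁⟩ := abs_Ai_le
    obtain ⟨C₂, h₂, hC₂⟩ := abs_KAi_le
    refine ⟨C₁ * Real.exp (-(ξ₀ - 1)) + C₂ * Real.exp (-(ξ₀ - 1)) ^ 2, by positivity,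
      fun ξ hξ => ?_⟩
    have hle : ξ₀ - 1 ≤ ξ := by
      rw [Metric.mem_ball, Real.dist_eq] at hξ
      linarith [(abs_lt.mp hξ).1]
    have hexp : ∀ x, Real.exp (-(ξ + x)) ≤ Real.exp (-(ξ₀ - 1)) * airyWeight x := fun x => by
      rw [neg_add, Real.exp_add]
      exact mul_le_mul (Real.exp_le_exp.mpr (by linarith)) (exp_neg_le_airyWeight x)
        (Real.exp_nonneg _) (Real.exp_nonneg _)
    have hw : ∀ x, 0 ≤ airyWeight x := isWeight_airyWeight.nonneg
    have hAi : ∀ x, C₁ * Real.exp (-(ξ + x)) ≤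
        (C₁ * Real.exp (-(ξ₀ - 1)) + C₂ * Real.exp (-(ξ₀ - 1)) ^ 2) * airyWeight x := fun x => by
      have h3 := mul_le_mul_of_nonneg_left (hexp x) h₁
      have h4 : 0 ≤ C₂ * Real.exp (-(ξ₀ - 1)) ^ 2 * airyWeight x :=
        mul_nonneg (by positivity) (hw x)
      linarith
    refine ⟨fun x y => (hC₂ ξ x y).trans ?_, fun x => (hC₁ _).1.trans (hAi x),
      fun x => (hC₁ _).2.trans (hAi x)⟩
    have h3 : C₂ * Real.exp (-(ξ + x)) * Real.exp (-(ξ + y)) ≤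
        C₂ * ((Real.exp (-(ξ₀ - 1)) * airyWeight x) * (Real.exp (-(ξ₀ - 1)) * airyWeight y)) := by
      rw [mul_assoc]
      exact mul_le_mul_of_nonneg_left (mul_le_mul (hexp x) (hexp y) (Real.exp_nonneg _)
        (mul_nonneg (Real.exp_nonneg _) (hw x))) h₂
    have h4 : 0 ≤ C₁ * Real.exp (-(ξ₀ - 1)) * (airyWeight x * airyWeight y) :=
      mul_nonneg (by positivity) (mul_nonneg (hw x) (hw y))
    linarith

theorem F₂_eq (ξ : ℝ) : F₂ ξ = ∑' n, fredholmTerm (volume.restrict (Set.Ioi 0)) (KAi ξ) n := by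
  refine tsum_congr fun n => ?_
  have hset : {x : Fin n → ℝ | ∀ i, 0 < x i} = Set.pi Set.univ fun _ => Set.Ioi 0 := by
    ext x
    simp
  have hneg : ∀ x : Fin n → ℝ, (Matrix.of fun i j => -KAi ξ (x i) (x j)).det =
      (-1) ^ n * (Matrix.of fun i j => KAi ξ (x i) (x j)).det := fun x => by
    have := Matrix.det_neg (Matrix.of fun i j => KAi ξ (x i) (x j))
    rw [Fintype.card_fin] at this
    exact this
  simp only [hneg]
  rw [integral_const_mul, fredholmTerm, fredholmCoeff, hset, volume_pi, Measure.restrict_pi_pi]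
  ring

lemma Ai_eq_zero_of_common_zero {u : ℝ} (h₀ : Ai u = 0) (h₁ : deriv Ai u = 0) (x : ℝ) :
    Ai x = 0 := by
  have hq (y : ℝ) : HasDerivAt (fun z => Ai z ^ 2 + deriv Ai z ^ 2)
      (2 * Ai y * deriv Ai y * (1 + y)) y := by
    refine (((hasDerivAt_Ai y).pow 2).add ((hasDerivAt_deriv_Ai y).pow 2)).congr_deriv ?_
    ring
  have hp (y : ℝ) : HasDerivAt (fun z : ℝ => 2 * z + z ^ 3 / 3) (2 + y ^ 2) y := by
    refine (((hasDerivAt_id y).const_mul 2).add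
      (((hasDerivAt_id y).pow 3).div_const 3)).congr_deriv ?_
    simp
  have hup (y : ℝ) := (hq y).mul (hp y).exp
  have hdown (y : ℝ) := (hq y).mul (hp y).neg.exp
  have hle : Ai x ^ 2 + deriv Ai x ^ 2 ≤ 0 := by
    rcases le_total x u with hxu | hxu
    · have hmono := monotone_of_hasDerivAt_nonneg hup (fun y => by
        have := Real.exp_pos (2 * y + y ^ 3 / 3)
        have h : 0 ≤ 2 * Ai y * deriv Ai y * (1 + y)
            + (Ai y ^ 2 + deriv Ai y ^ 2) * (2 + y ^ 2) := by
          nlinarith [mul_nonneg (by nlinarith [sq_nonneg (y + 1)] : 0 ≤ y ^ 2 + y + 3)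
            (sq_nonneg (Ai y + deriv Ai y)),
            mul_nonneg (by nlinarith [sq_nonneg (y - 1)] : 0 ≤ y ^ 2 - y + 1)
            (sq_nonneg (Ai y - deriv Ai y))]
        simp only [Pi.zero_apply]
        nlinarith [mul_nonneg h this.le])
      have h := hmono hxu
      simp only [Pi.mul_apply, h₀, h₁] at h
      exact nonpos_of_mul_nonpos_left (by simpa using h) (Real.exp_pos _)
    · have hanti := antitone_of_hasDerivAt_nonpos hdown (fun y => by
        have := Real.exp_pos (-(2 * y + y ^ 3 / 3))
        have h : 2 * Ai y * deriv Ai y * (1 + y)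
            - (Ai y ^ 2 + deriv Ai y ^ 2) * (2 + y ^ 2) ≤ 0 := by
          nlinarith [mul_nonneg (by nlinarith [sq_nonneg (y + 1)] : 0 ≤ y ^ 2 + y + 3)
            (sq_nonneg (Ai y - deriv Ai y)),
            mul_nonneg (by nlinarith [sq_nonneg (y - 1)] : 0 ≤ y ^ 2 - y + 1)
            (sq_nonneg (Ai y + deriv Ai y))]
        simp only [Pi.zero_apply]
        have := mul_nonneg (neg_nonneg.2 h) this.le
        simp only [Pi.neg_apply]
        nlinarith [this])
      have h := hanti hxu
      simp only [Pi.mul_apply, h₀, h₁] at h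
      exact nonpos_of_mul_nonpos_left (by simpa using h) (Real.exp_pos _)
  nlinarith [sq_nonneg (Ai x), sq_nonneg (deriv Ai x)]

lemma Ai_energy_pos (hA : ∃ x, Ai x ≠ 0) (u : ℝ) : 0 < deriv Ai u ^ 2 - u * Ai u ^ 2 := by
  have hd (y : ℝ) : HasDerivAt (fun z => deriv Ai z ^ 2 - z * Ai z ^ 2) (-Ai y ^ 2) y := by
    refine (((hasDerivAt_deriv_Ai y).pow 2).sub
      ((hasDerivAt_id y).mul ((hasDerivAt_Ai y).pow 2))).congr_deriv ?_
    simp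
    ring
  have hanti : Antitone fun z => deriv Ai z ^ 2 - z * Ai z ^ 2 :=
    antitone_of_hasDerivAt_nonpos hd fun y => by simp [sq_nonneg]
  obtain ⟨C, hC, hb⟩ := abs_Ai_le
  have hlim : Filter.Tendsto (fun z => deriv Ai z ^ 2 - z * Ai z ^ 2) Filter.atTop (nhds 0) := by
    refine tendsto_zero_of_abs_le_exp (M := 2 * C ^ 2) fun s hs => ?_
    obtain ⟨h₁, h₂⟩ := hb s
    have hsq (p : ℝ) (hp : |p| ≤ C * Real.exp (-s)) : p ^ 2 ≤ C ^ 2 * Real.exp (-s) ^ 2 := by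
      rw [← sq_abs, ← mul_pow]
      exact pow_le_pow_left₀ (abs_nonneg _) hp 2
    have he : Real.exp (-s) ≤ 1 := Real.exp_le_one_iff.2 (by linarith)
    have he0 := Real.exp_pos (-s)
    have hse : s * Real.exp (-s) ≤ 1 := by
      have h := mul_le_mul_of_nonneg_right
        (show s ≤ Real.exp s by linarith [Real.add_one_le_exp s]) he0.le
      rwa [← Real.exp_add, add_neg_cancel, Real.exp_zero] at h
    have hp1 : deriv Ai s ^ 2 ≤ C ^ 2 * Real.exp (-s) := by
      refine (hsq _ h₂).trans (mul_le_mul_of_nonneg_left ?_ (sq_nonneg C))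
      nlinarith
    have hp2 : s * Ai s ^ 2 ≤ C ^ 2 * Real.exp (-s) := by
      refine (mul_le_mul_of_nonneg_left (hsq _ h₁) hs.le).trans ?_
      have : C ^ 2 * (Real.exp (-s) * (s * Real.exp (-s))) ≤ C ^ 2 * (Real.exp (-s) * 1) := by
        gcongr
      nlinarith
    have := mul_nonneg hs.le (sq_nonneg (Ai s))
    rw [abs_le]
    constructor <;> nlinarith [sq_nonneg (deriv Ai s)]
  by_contra hneg
  have hnonneg (z : ℝ) : 0 ≤ deriv Ai z ^ 2 - z * Ai z ^ 2 := hanti.le_of_tendsto hlim z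
  have hzero (z : ℝ) (hz : u ≤ z) : deriv Ai z ^ 2 - z * Ai z ^ 2 = 0 :=
    le_antisymm ((hanti hz).trans (not_lt.1 hneg)) (hnonneg z)
  have heq : (fun z => deriv Ai z ^ 2 - z * Ai z ^ 2) =ᶠ[nhds (u + 1)] fun _ => 0 := by
    filter_upwards [lt_mem_nhds (lt_add_one u)] with z hz using hzero z hz.le
  have hA0 : Ai (u + 1) = 0 := by
    have h := heq.hasDerivAt_iff.1 (hd (u + 1))
    have := h.unique (hasDerivAt_const _ _)
    simpa using this
  have hA1 : deriv Ai (u + 1) = 0 := by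
    simpa [hA0] using hzero (u + 1) (by linarith)
  obtain ⟨x, hx⟩ := hA
  exact hx (Ai_eq_zero_of_common_zero hA0 hA1 x)

lemma antitoneOn_abs_Ai : AntitoneOn (fun x => |Ai x|) (Set.Ici 0) := by
  have hp (y : ℝ) : HasDerivAt (fun z => Ai z * deriv Ai z) (deriv Ai y ^ 2 + y * Ai y ^ 2) y := by
    refine ((hasDerivAt_Ai y).mul (hasDerivAt_deriv_Ai y)).congr_deriv ?_
    ring
  have hmono : MonotoneOn (fun z => Ai z * deriv Ai z) (Set.Ici 0) := by
    refine monotoneOn_of_deriv_nonneg (convex_Ici 0)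
      (fun y _ => (hp y).continuousAt.continuousWithinAt)
      (fun y _ => (hp y).differentiableAt.differentiableWithinAt) fun y hy => ?_
    rw [interior_Ici] at hy
    rw [(hp y).deriv]
    have := mul_nonneg (le_of_lt hy) (sq_nonneg (Ai y))
    nlinarith [sq_nonneg (deriv Ai y)]
  obtain ⟨C, hC, hb⟩ := abs_Ai_le
  have hlim : Filter.Tendsto (fun z => Ai z * deriv Ai z) Filter.atTop (nhds 0) := by
    refine tendsto_zero_of_abs_le_exp (M := C ^ 2) fun s hs => ?_
    have := abs_mul_le_of_abs_le_exp (a := 0) (b := 0) (C := C)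
      (by simpa using (hb s).1) (by simpa using (hb s).2) hs
    simpa using this
  have hnonpos (z : ℝ) (hz : 0 ≤ z) : Ai z * deriv Ai z ≤ 0 := by
    refine ge_of_tendsto hlim ?_
    filter_upwards [Filter.eventually_ge_atTop z] with t ht
    exact hmono hz (hz.trans ht) ht
  have hsq (y : ℝ) : HasDerivAt (fun z => Ai z ^ 2) (2 * (Ai y * deriv Ai y)) y := by
    refine ((hasDerivAt_Ai y).pow 2).congr_deriv ?_
    ring
  have hanti : AntitoneOn (fun z => Ai z ^ 2) (Set.Ici 0) := by
    refine antitoneOn_of_deriv_nonpos (convex_Ici 0)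
      (fun y _ => (hsq y).continuousAt.continuousWithinAt)
      (fun y _ => (hsq y).differentiableAt.differentiableWithinAt) fun y hy => ?_
    rw [interior_Ici] at hy
    rw [(hsq y).deriv]
    linarith [hnonpos y (le_of_lt hy)]
  exact fun x hx y hy hxy => sq_le_sq.1 (hanti hx hy hxy)

lemma Ai_norm_pos (hA : ∃ x, Ai x ≠ 0) (u : ℝ) : 0 < |Ai u| + |deriv Ai u| := by
  by_contra h
  have h₁ := abs_nonneg (Ai u)
  have h₂ := abs_nonneg (deriv Ai u)
  obtain ⟨x, hx⟩ := hA
  exact hx (Ai_eq_zero_of_common_zero (abs_eq_zero.1 (by linarith))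
    (abs_eq_zero.1 (by linarith)) x)

lemma exists_abs_Ai_add_le (hA : ∃ x, Ai x ≠ 0) (ξ : ℝ) :
    ∃ c, 0 ≤ c ∧ ∀ l s, 0 ≤ l → 0 ≤ s →
      |Ai (ξ + l + s)| ≤ c * (|Ai (ξ + l)| + |deriv Ai (ξ + l)|) := by
  obtain ⟨C, hC, hb⟩ := abs_Ai_le
  obtain ⟨x₀, -, hx₀⟩ := isCompact_Icc.exists_isMinOn (s := Set.Icc (-|ξ|) |ξ|)
    (f := fun u => |Ai u| + |deriv Ai u|) ⟨0, by simp⟩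
    (continuous_Ai.abs.add continuous_deriv_Ai.abs).continuousOn
  have hm := Ai_norm_pos hA x₀
  set m := |Ai x₀| + |deriv Ai x₀| with hm_def
  refine ⟨1 + C * Real.exp |ξ| / m, by positivity, fun l s hl hs => ?_⟩
  have hN : 0 ≤ |Ai (ξ + l)| + |deriv Ai (ξ + l)| := by positivity
  rcases le_total 0 (ξ + l) with h | h
  · have h₁ := antitoneOn_abs_Ai (Set.mem_Ici.2 h) (Set.mem_Ici.2 (add_nonneg h hs))
      (le_add_of_nonneg_right hs)
    have h₂ : 0 ≤ C * Real.exp |ξ| / m := by positivity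
    simp only at h₁
    nlinarith [abs_nonneg (deriv Ai (ξ + l)), mul_nonneg h₂ hN]
  · have hle : m ≤ |Ai (ξ + l)| + |deriv Ai (ξ + l)| := by
      refine hx₀ ⟨?_, h.trans (abs_nonneg _)⟩
      linarith [neg_abs_le ξ]
    have h₁ : |Ai (ξ + l + s)| ≤ C * Real.exp |ξ| := by
      refine (hb _).1.trans ?_
      gcongr
      linarith [neg_abs_le ξ]
    have h₂ : C * Real.exp |ξ| / m * m ≤
        C * Real.exp |ξ| / m * (|Ai (ξ + l)| + |deriv Ai (ξ + l)|) := by gcongr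
    rw [div_mul_cancel₀ _ hm.ne'] at h₂
    linarith

lemma exists_abs_KAi_le_norm (hA : ∃ x, Ai x ≠ 0) (ξ : ℝ) :
    ∃ c, 0 ≤ c ∧ ∀ v l, 0 ≤ l →
      |KAi ξ v l| ≤ c * Real.exp (-v) * (|Ai (ξ + l)| + |deriv Ai (ξ + l)|) := by
  obtain ⟨C, hC, hb⟩ := abs_Ai_le
  obtain ⟨c, hc, hcb⟩ := exists_abs_Ai_add_le hA ξ
  refine ⟨C * Real.exp (-ξ) * c, by positivity, fun v l hl => ?_⟩
  refine abs_setIntegral_Ioi_le_of_abs_le_exp fun s hs => ?_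
  rw [abs_mul]
  refine (mul_le_mul (hb _).1 (hcb l s hl hs.le) (abs_nonneg _) (by positivity)).trans_eq ?_
  rw [show -(ξ + v + s) = -ξ + -v + -s by ring, Real.exp_add, Real.exp_add]
  ring

lemma exists_abs_KAi_mul_le_norm (hA : ∃ x, Ai x ≠ 0) (ξ : ℝ) :
    ∃ c, 0 ≤ c ∧ ∀ v l V, 0 ≤ l → 0 ≤ V →
      |KAi ξ v l| * (V + l) ≤
        c * (V + 1) * airyWeight v * (|Ai (ξ + l)| + |deriv Ai (ξ + l)|) := by
  obtain ⟨C, hC, hb⟩ := abs_Ai_le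
  obtain ⟨c, hc, hcb⟩ := exists_abs_KAi_le_norm hA ξ
  refine ⟨c + 2 * C * Real.exp (-ξ), by positivity, fun v l V hl hV => ?_⟩
  set N := |Ai (ξ + l)| + |deriv Ai (ξ + l)| with hN_def
  have hN : 0 ≤ N := by positivity
  have he := Real.exp_pos (-v)
  rw [airyWeight]
  rcases le_total |v - l| 1 with h | h
  · have h₁ : V + l ≤ (V + 1) * (2 + |v|) := by
      nlinarith [neg_abs_le (v - l), le_abs_self v, abs_nonneg v, mul_nonneg hV (abs_nonneg v)]
    calc |KAi ξ v l| * (V + l) ≤ (c * Real.exp (-v) * N) * ((V + 1) * (2 + |v|)) :=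
          mul_le_mul (hcb v l hl) h₁ (by positivity) (by positivity)
      _ ≤ (c * Real.exp (-v) * N) * ((V + 1) * (2 + |v|)) +
          2 * C * Real.exp (-ξ) * (Real.exp (-v) * N) * ((V + 1) * (2 + |v|)) :=
          le_add_of_nonneg_right (by positivity)
      _ = _ := by ring
  · have h₁ : V + l ≤ (V + 1) * (2 + |v|) * |v - l| := by
      have : l ≤ |v| + |v - l| := by
        linarith [neg_abs_le (v - l), le_abs_self v]
      nlinarith [abs_nonneg v, mul_nonneg hV (abs_nonneg v), mul_nonneg hV (sub_nonneg.2 h),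
        mul_nonneg (abs_nonneg v) (sub_nonneg.2 h),
        mul_nonneg (mul_nonneg hV (abs_nonneg v)) (abs_nonneg (v - l))]
    have h₂ : |KAi ξ v l| * |v - l| ≤ 2 * C * Real.exp (-ξ) * (Real.exp (-v) * N) := by
      rw [mul_comm, ← abs_mul, sub_mul_KAi]
      refine (abs_sub _ _).trans ?_
      rw [abs_mul, abs_mul]
      obtain ⟨h₃, h₄⟩ := hb (ξ + v)
      rw [neg_add, Real.exp_add] at h₃ h₄
      have h₅ := mul_le_mul h₃ (le_add_of_nonneg_left (abs_nonneg (Ai (ξ + l))) : _ ≤ N)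
        (abs_nonneg _) (by positivity)
      have h₆ := mul_le_mul h₄ (le_add_of_nonneg_right (abs_nonneg (deriv Ai (ξ + l))) : _ ≤ N)
        (abs_nonneg _) (by positivity)
      linarith
    calc |KAi ξ v l| * (V + l) ≤ |KAi ξ v l| * ((V + 1) * (2 + |v|) * |v - l|) := by gcongr
      _ = |KAi ξ v l| * |v - l| * ((V + 1) * (2 + |v|)) := by ring
      _ ≤ 2 * C * Real.exp (-ξ) * (Real.exp (-v) * N) * ((V + 1) * (2 + |v|)) := by gcongr
      _ ≤ (c * Real.exp (-v) * N) * ((V + 1) * (2 + |v|)) +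
          2 * C * Real.exp (-ξ) * (Real.exp (-v) * N) * ((V + 1) * (2 + |v|)) :=
          le_add_of_nonneg_left (by positivity)
      _ = _ := by ring

lemma countable_zeros_Ai_combination (hA : ∃ x, Ai x ≠ 0) (v : ℝ) :
    {x | Ai v * deriv Ai x - deriv Ai v * Ai x = 0}.Countable := by
  refine (HereditarilyLindelofSpace.isLindelof _).countable_of_isDiscrete
    (isDiscrete_iff_nhdsNE.2 fun x hx => ?_)
  have hd : HasDerivAt (fun x => Ai v * deriv Ai x - deriv Ai v * Ai x)
      (Ai v * (x * Ai x) - deriv Ai v * deriv Ai x) x :=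
    ((hasDerivAt_deriv_Ai x).const_mul _).sub ((hasDerivAt_Ai x).const_mul _)
  have hne : Ai v * (x * Ai x) - deriv Ai v * deriv Ai x ≠ 0 := by
    intro h
    have hx' : Ai v * deriv Ai x - deriv Ai v * Ai x = 0 := hx
    have hE := Ai_energy_pos hA x
    have h₁ : Ai v * (deriv Ai x ^ 2 - x * Ai x ^ 2) = 0 := by
      linear_combination deriv Ai x * hx' - Ai x * h
    have h₂ : deriv Ai v * (deriv Ai x ^ 2 - x * Ai x ^ 2) = 0 := by
      linear_combination x * Ai x * hx' - deriv Ai x * h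
    obtain ⟨y, hy⟩ := hA
    exact hy (Ai_eq_zero_of_common_zero ((mul_eq_zero.1 h₁).resolve_right hE.ne')
      ((mul_eq_zero.1 h₂).resolve_right hE.ne') y)
  have := hd.eventually_ne hne (c := 0)
  rw [Filter.inf_principal_eq_bot]
  exact this

/-- A pointwise solution of the Airy resolvent equation is integrable against two rows of the
kernel whose Airy data are linearly independent. -/
lemma exists_integrable_pair (hA : ∃ x, Ai x ≠ 0) {ξ y : ℝ} {r : ℝ → ℝ}
    (hr : ∀ v, r v = KAi ξ v y + ∫ l in Set.Ioi 0, KAi ξ v l * r l) :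
    ∃ v₁ v₂, IntegrableOn (fun l => KAi ξ v₁ l * r l) (Set.Ioi 0) ∧
      IntegrableOn (fun l => KAi ξ v₂ l * r l) (Set.Ioi 0) ∧
      Ai (ξ + v₁) * deriv Ai (ξ + v₂) - deriv Ai (ξ + v₁) * Ai (ξ + v₂) ≠ 0 := by
  set S := {v | IntegrableOn (fun l => KAi ξ v l * r l) (Set.Ioi 0)} with hS
  have hunc : ¬ S.Countable := by
    intro hcount
    have hae : r =ᵐ[volume.restrict (Set.Ioi 0)] fun v => KAi ξ v y := by
      have : ∀ᵐ v ∂(volume.restrict (Set.Ioi (0 : ℝ))), v ∉ S :=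
        ae_restrict_of_ae (hcount.ae_notMem volume)
      filter_upwards [this] with v hv
      rw [hr v, integral_undef hv, add_zero]
    obtain ⟨C, hC, hb⟩ := abs_KAi_le
    have hall (v : ℝ) : v ∈ S := by
      have h₀ : IntegrableOn (fun l => KAi ξ v l * KAi ξ l y) (Set.Ioi 0) := by
        have hdom : Integrable (fun l : ℝ => C * Real.exp (-(ξ + v)) * Real.exp (-ξ) *
            (C * Real.exp (-ξ) * Real.exp (-(ξ + y))) * Real.exp (-l))
            (volume.restrict (Set.Ioi 0)) := (integrableOn_exp_neg_Ioi 0).const_mul _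
        refine hdom.mono' ?_ ?_
        · exact (((measurable_KAi ξ).comp measurable_prodMk_left).mul
            ((measurable_KAi ξ).comp measurable_prodMk_right)).aestronglyMeasurable
        · refine (ae_restrict_iff' measurableSet_Ioi).2 (Filter.Eventually.of_forall fun l hl => ?_)
          have h₁ := hb ξ v l
          have h₂ := hb ξ l y
          have hl1 : Real.exp (-l) ≤ 1 := Real.exp_le_one_iff.2 (by linarith [Set.mem_Ioi.1 hl])
          rw [neg_add ξ l, Real.exp_add (-ξ) (-l)] at h₁ h₂
          rw [Real.norm_eq_abs, abs_mul]
          calc _ ≤ _ := mul_le_mul h₁ h₂ (abs_nonneg _) (by positivity)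
            _ = C * Real.exp (-(ξ + v)) * Real.exp (-ξ) *
              (C * Real.exp (-ξ) * Real.exp (-(ξ + y))) * Real.exp (-l) * Real.exp (-l) := by ring
            _ ≤ _ := mul_le_of_le_one_right (by positivity) hl1
      refine h₀.congr ?_
      filter_upwards [hae] with l hl
      rw [hl]
    have huniv : S = Set.univ := Set.eq_univ_of_forall hall
    rw [huniv] at hcount
    exact Set.not_countable_univ hcount
  obtain ⟨v₁, hv₁⟩ : S.Nonempty := Set.nonempty_iff_ne_empty.2 fun h => hunc (by simp [h])
  have hZ : {v | Ai (ξ + v₁) * deriv Ai (ξ + v) - deriv Ai (ξ + v₁) * Ai (ξ + v) = 0}.Countable :=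
    (countable_zeros_Ai_combination hA (ξ + v₁)).preimage (add_right_injective ξ)
  obtain ⟨v₂, hv₂, hne⟩ : ∃ v ∈ S,
      Ai (ξ + v₁) * deriv Ai (ξ + v) - deriv Ai (ξ + v₁) * Ai (ξ + v) ≠ 0 := by
    by_contra! h
    exact hunc (hZ.mono h)
  exact ⟨v₁, v₂, hv₁, hv₂, hne⟩

lemma aestronglyMeasurable_and_abs_le_of_eq (hA : ∃ x, Ai x ≠ 0) {ξ y : ℝ} {r : ℝ → ℝ}
    (hr : ∀ v, r v = KAi ξ v y + ∫ l in Set.Ioi 0, KAi ξ v l * r l) :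
    AEStronglyMeasurable r (volume.restrict (Set.Ioi 0)) ∧
      ∃ B, ∀ v, |r v| ≤ B * airyWeight v := by
  obtain ⟨v₁, v₂, hi₁, hi₂, hW⟩ := exists_integrable_pair hA hr
  obtain ⟨a₁, ha₁⟩ : ∃ a, a = Ai (ξ + v₁) := ⟨_, rfl⟩
  obtain ⟨b₁, hb₁⟩ : ∃ b, b = deriv Ai (ξ + v₁) := ⟨_, rfl⟩
  obtain ⟨a₂, ha₂⟩ : ∃ a, a = Ai (ξ + v₂) := ⟨_, rfl⟩
  obtain ⟨b₂, hb₂⟩ : ∃ b, b = deriv Ai (ξ + v₂) := ⟨_, rfl⟩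
  rw [← ha₁, ← hb₁, ← ha₂, ← hb₂] at hW
  set W := a₁ * b₂ - b₁ * a₂ with hW_def
  let g (p q l : ℝ) : ℝ :=
    p * ((v₁ - l) * (KAi ξ v₁ l * r l)) - q * ((v₂ - l) * (KAi ξ v₂ l * r l))
  have hg_meas (p q : ℝ) : AEStronglyMeasurable (g p q) (volume.restrict (Set.Ioi 0)) :=
    ((((continuous_const.sub continuous_id).aestronglyMeasurable.mul
      hi₁.aestronglyMeasurable).const_mul p).sub
      (((continuous_const.sub continuous_id).aestronglyMeasurable.mul
      hi₂.aestronglyMeasurable).const_mul q))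
  have hgA (l : ℝ) : W * (Ai (ξ + l) * r l) = g a₂ a₁ l := by
    have h₁ := sub_mul_KAi ξ v₁ l
    have h₂ := sub_mul_KAi ξ v₂ l
    rw [← ha₁, ← hb₁] at h₁
    rw [← ha₂, ← hb₂] at h₂
    simp only [g, hW_def]
    linear_combination (-a₂ * r l) * h₁ + a₁ * r l * h₂
  have hgB (l : ℝ) : W * (deriv Ai (ξ + l) * r l) = g b₂ b₁ l := by
    have h₁ := sub_mul_KAi ξ v₁ l
    have h₂ := sub_mul_KAi ξ v₂ l
    rw [← ha₁, ← hb₁] at h₁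
    rw [← ha₂, ← hb₂] at h₂
    simp only [g, hW_def]
    linear_combination (-b₂ * r l) * h₁ + b₁ * r l * h₂
  constructor
  · have hq (l : ℝ) : Ai (ξ + l) ^ 2 + deriv Ai (ξ + l) ^ 2 ≠ 0 := by
      intro h
      have h₁ := sq_nonneg (Ai (ξ + l))
      have h₂ := sq_nonneg (deriv Ai (ξ + l))
      obtain ⟨x, hx⟩ := hA
      exact hx (Ai_eq_zero_of_common_zero (pow_eq_zero_iff two_ne_zero |>.1 (by linarith))
        (pow_eq_zero_iff two_ne_zero |>.1 (by linarith)) x)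
    have hcA : Continuous fun l => Ai (ξ + l) := continuous_Ai.comp (continuous_const_add ξ)
    have hcB : Continuous fun l => deriv Ai (ξ + l) :=
      continuous_deriv_Ai.comp (continuous_const_add ξ)
    have hcq : Continuous fun l => (W * (Ai (ξ + l) ^ 2 + deriv Ai (ξ + l) ^ 2))⁻¹ :=
      (continuous_const.mul ((hcA.pow 2).add (hcB.pow 2))).inv₀ fun l => mul_ne_zero hW (hq l)
    have hr_eq : r = fun l => (W * (Ai (ξ + l) ^ 2 + deriv Ai (ξ + l) ^ 2))⁻¹ *
        (Ai (ξ + l) * g a₂ a₁ l + deriv Ai (ξ + l) * g b₂ b₁ l) := by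
      funext l
      rw [← hgA, ← hgB, eq_inv_mul_iff_mul_eq₀ (mul_ne_zero hW (hq l))]
      ring
    rw [hr_eq]
    exact hcq.aestronglyMeasurable.mul ((hcA.aestronglyMeasurable.mul (hg_meas _ _)).add
      (hcB.aestronglyMeasurable.mul (hg_meas _ _)))
  · obtain ⟨c, hc, hcb⟩ := exists_abs_KAi_mul_le_norm hA ξ
    obtain ⟨C, hC, hKb⟩ := abs_KAi_le
    set Φ : ℝ → ℝ := fun l => |KAi ξ v₁ l * r l| + |KAi ξ v₂ l * r l| with hΦ
    have hΦi : IntegrableOn Φ (Set.Ioi 0) := hi₁.abs.add hi₂.abs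
    have hΦ0 (l : ℝ) : 0 ≤ Φ l := by positivity
    set V := |v₁| + |v₂| with hV
    set M := |a₁| + |b₁| + |a₂| + |b₂| with hM
    have hg_le (p q l : ℝ) (hl : 0 ≤ l) : |g p q l| ≤ (|p| + |q|) * ((V + l) * Φ l) := by
      have hsub (v : ℝ) (hv : |v| ≤ V) : |v - l| ≤ V + l := by
        refine (abs_sub _ _).trans ?_
        rw [abs_of_nonneg hl]
        linarith
      have h₁ := hsub v₁ (le_add_of_nonneg_right (abs_nonneg _))
      have h₂ := hsub v₂ (le_add_of_nonneg_left (abs_nonneg _))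
      refine (abs_sub _ _).trans ?_
      rw [abs_mul p, abs_mul (v₁ - l), abs_mul q, abs_mul (v₂ - l), add_mul]
      gcongr
      · exact le_add_of_nonneg_right (abs_nonneg _)
      · exact le_add_of_nonneg_left (abs_nonneg _)
    have hpt (v l : ℝ) (hl : 0 < l) :
        |KAi ξ v l * r l| ≤ c * (V + 1) * airyWeight v * M / |W| * Φ l := by
      have hN := Ai_norm_pos hA (ξ + l)
      set N := |Ai (ξ + l)| + |deriv Ai (ξ + l)| with hN_def
      have hWpos := abs_pos.2 hW
      have h₁ : |W| * (N * |r l|) ≤ M * ((V + l) * Φ l) := by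
        have hA' := hg_le a₂ a₁ l hl.le
        have hB' := hg_le b₂ b₁ l hl.le
        rw [← hgA, abs_mul, abs_mul] at hA'
        rw [← hgB, abs_mul, abs_mul] at hB'
        rw [hN_def, hM]
        linarith
      have h₂ := hcb v l V hl.le (by positivity)
      rw [abs_mul]
      refine le_of_mul_le_mul_left ?_ (mul_pos hWpos hN)
      calc |W| * N * (|KAi ξ v l| * |r l|) = |KAi ξ v l| * (|W| * (N * |r l|)) := by ring
        _ ≤ |KAi ξ v l| * (M * ((V + l) * Φ l)) := by gcongr
        _ = |KAi ξ v l| * (V + l) * (M * Φ l) := by ring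
        _ ≤ c * (V + 1) * airyWeight v * N * (M * Φ l) :=
          mul_le_mul_of_nonneg_right h₂ (mul_nonneg (by positivity) (hΦ0 l))
        _ = |W| * N * (c * (V + 1) * airyWeight v * M / |W| * Φ l) := by
          field_simp
    refine ⟨C * Real.exp (-ξ) * Real.exp (-(ξ + y)) +
      c * (V + 1) * M / |W| * ∫ l in Set.Ioi 0, Φ l, fun v => ?_⟩
    have hint : |∫ l in Set.Ioi 0, KAi ξ v l * r l| ≤
        c * (V + 1) * airyWeight v * M / |W| * ∫ l in Set.Ioi 0, Φ l := by
      rw [← integral_const_mul]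
      exact norm_integral_le_of_norm_le (f := fun l => KAi ξ v l * r l) (hΦi.const_mul _)
        ((ae_restrict_iff' measurableSet_Ioi).2 (Filter.Eventually.of_forall (hpt v)))
    have hK : |KAi ξ v y| ≤ C * Real.exp (-ξ) * Real.exp (-(ξ + y)) * airyWeight v := by
      refine (hKb ξ v y).trans ?_
      rw [neg_add ξ v, Real.exp_add]
      calc _ = C * Real.exp (-ξ) * Real.exp (-(ξ + y)) * Real.exp (-v) := by ring
        _ ≤ _ := mul_le_mul_of_nonneg_left (exp_neg_le_airyWeight v) (by positivity)
    rw [hr v]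
    refine (abs_add_le _ _).trans ((add_le_add hK hint).trans_eq ?_)
    ring

/-- With `η₂ = 0`, `A(v) = Ai(ξ₂+v)`, `A^{(1)} = −A'`, and `K = K_{Ai,ξ₂}`,
`a₁(ξ₂) = tr (I−K)⁻¹ A^{(1)} ⊗ A = −F₂''(ξ₂)/(2F₂(ξ₂))`, where the trace is expressed
via the resolvent kernel `R = (I−K)⁻¹K` (so `(I−K)⁻¹ = I + R`). -/
theorem a1_eq_tracy_widom_second_deriv (ξ₂ : ℝ) (R : ℝ → ℝ → ℝ)
    (hR : ∀ v₁ v₂ : ℝ, R v₁ v₂ = KAi ξ₂ v₁ v₂ + kComp (KAi ξ₂) R v₁ v₂) :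
    (∫ v in Set.Ioi (0 : ℝ), (-(deriv Ai (ξ₂ + v))) * Ai (ξ₂ + v)) +
      (∫ v₁ in Set.Ioi (0 : ℝ), ∫ v₂ in Set.Ioi (0 : ℝ),
        R v₁ v₂ * (-(deriv Ai (ξ₂ + v₂))) * Ai (ξ₂ + v₁)) =
      -(iteratedDeriv 2 F₂ ξ₂) / (2 * F₂ ξ₂) := by
  have hR' (a y : ℝ) : R a y = KAi ξ₂ a y + ∫ l in Set.Ioi 0, KAi ξ₂ a l * R l y := hR a y
  have hsol (y : ℝ) : AEStronglyMeasurable (fun l => R l y) (volume.restrict (Set.Ioi 0)) ∧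
      ∃ B, ∀ l, |R l y| ≤ B * airyWeight l := by
    by_cases hA : ∃ x, Ai x ≠ 0
    · exact aestronglyMeasurable_and_abs_le_of_eq hA fun v => hR' v y
    · push Not at hA
      have hR0 (l : ℝ) : R l y = 0 := by
        rw [hR' l y]
        simp [KAi, hA]
      simp only [hR0]
      exact ⟨aestronglyMeasurable_const, 0, fun l => by simp⟩
  obtain ⟨hne, hd⟩ := isRankOneFlow_KAi.iteratedDeriv_two_eq isWeight_airyWeight
    (fun y => (hsol y).1) (fun y => (hsol y).2) hR'
  simp only [← F₂_eq] at hne hd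
  simp only [neg_mul, mul_neg, integral_neg]
  rw [hd]
  field_simp
  ring
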